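/- arXiv:1803.06847 — 2 statements merged into one kernel-verified Lean document; each statement's English description precedes it below -/
import Mathlib

section
/- Let p ≥ 1. There exists a constant C(p) > 0, depending only on p, such that for every n, every linear isomorphism T of the hyperplane θ0^⊥ (θ0 = (1/√n,…,1/√n)), and every random vector X uniformly distributed on T(P_{θ0^⊥}B_p^n), one has Var(|X|²) ≤ C(p) · λ_X² · E[|X|²], where λ_X² = max over unit vectors ξ ∈ θ0^⊥ of E[⟨X,ξ⟩²] is the largest eigenvalue of the covariance matrix of X. -/
open MeasureTheory Real
open scoped RealInnerProductSpace ENNReal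

noncomputable section

/-- `ℝⁿ` with the Euclidean structure. -/
abbrev E (n : ℕ) := EuclideanSpace ℝ (Fin n)

/-- The unit ball of the `ℓ_p` norm on `ℝⁿ`. -/
def lpBall (n : ℕ) (p : ℝ) : Set (E n) := {x | ∑ i, |x i| ^ p ≤ 1}

/-- `f(η₁,η₂) = E⟨X,η₁⟩²⟨X,η₂⟩² - E⟨X,η₁⟩² E⟨X,η₂⟩²` for `X` distributed according to `μ`. -/
def covf {n : ℕ} (μ : Measure (E n)) (a b : E n) : ℝ :=
  (∫ x, ⟪x, a⟫ ^ 2 * ⟪x, b⟫ ^ 2 ∂μ) - (∫ x, ⟪x, a⟫ ^ 2 ∂μ) * (∫ x, ⟪x, b⟫ ^ 2 ∂μ)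

/-- The canonical basis vectors of `ℝⁿ`. -/
def stdb {n : ℕ} (i : Fin n) : E n := EuclideanSpace.single i 1

/-- The diagonal unit vector `θ₀ = (1/√n, …, 1/√n)`. -/
def theta0 (n : ℕ) : E n := (WithLp.equiv 2 (Fin n → ℝ)).symm (fun _ => (Real.sqrt n)⁻¹)

/-- The orthogonal projection onto the hyperplane `θ⊥` (for a unit vector `θ`). -/
def projPerp {n : ℕ} (θ : E n) (x : E n) : E n := x - ⟪x, θ⟫ • θ

/-- The uniform probability measure on a set `K ⊆ ℝⁿ`, given by the normalized `d`-dimensional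
Hausdorff measure. -/
def unifH {n : ℕ} (d : ℝ) (K : Set (E n)) : Measure (E n) :=
  (μH[d] K)⁻¹ • (μH[d]).restrict K

/-- The uniform probability measure on the hyperplane projection `P_{θ₀⊥} B_p^n`, given by the
normalized `(n-1)`-dimensional Hausdorff measure. -/
def unifProj (n : ℕ) (p : ℝ) : Measure (E n) :=
  unifH ((n : ℝ) - 1) (projPerp (theta0 n) '' lpBall n p)



namespace VC
open ProbabilityTheory

/-! ### Functions with all moments -/

set_option linter.unusedSectionVars false
set_option linter.unusedVariables false
set_option linter.style.haveILetI false
set_option linter.flexible false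

section Abstract

variable {Ω : Type*} [MeasurableSpace Ω] {P : Measure Ω} [IsProbabilityMeasure P]

/-- All moments finite. -/
def Good (P : Measure Ω) (f : Ω → ℝ) : Prop := ∀ q : ℕ, MemLp f (q : ℝ≥0∞) P

lemma Good.add {f g : Ω → ℝ} (hf : Good P f) (hg : Good P g) :
    Good P (fun x => f x + g x) := fun q => (hf q).add (hg q)

lemma Good.sub {f g : Ω → ℝ} (hf : Good P f) (hg : Good P g) :
    Good P (fun x => f x - g x) := fun q => (hf q).sub (hg q)

lemma Good.const (c : ℝ) : Good P (fun _ => c) := fun q => memLp_const c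

lemma Good.mul {f g : Ω → ℝ} (hf : Good P f) (hg : Good P g) :
    Good P (fun x => f x * g x) := by
  intro q
  have h1 := hf (q + q)
  have h2 := hg (q + q)
  haveI : ENNReal.HolderTriple ((q + q : ℕ) : ℝ≥0∞) ((q + q : ℕ) : ℝ≥0∞) (q : ℝ≥0∞) := by
    constructor
    push_cast
    rw [← two_mul, ← two_mul, ENNReal.mul_inv (by simp) (by simp), ← mul_assoc,
      ENNReal.mul_inv_cancel (by simp) (by simp), one_mul]
  exact h2.mul h1

lemma Good.const_mul {f : Ω → ℝ} (c : ℝ) (hf : Good P f) : Good P (fun x => c * f x) :=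
  (Good.const c).mul hf

lemma Good.pow {f : Ω → ℝ} (hf : Good P f) (k : ℕ) : Good P (fun x => f x ^ k) := by
  induction k with
  | zero => simpa using Good.const (P := P) 1
  | succ k ih => simpa only [pow_succ] using ih.mul hf

lemma Good.abs {f : Ω → ℝ} (hf : Good P f) : Good P (fun x => |f x|) := fun q => (hf q).abs

lemma Good.sum {ι : Type*} (s : Finset ι) {f : ι → Ω → ℝ} (hf : ∀ i ∈ s, Good P (f i)) :
    Good P (fun x => ∑ i ∈ s, f i x) := fun q => memLp_finsetSum s (fun i hi => hf i hi q)

lemma Good.int {f : Ω → ℝ} (hf : Good P f) : Integrable f P := by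
  have := hf 1
  rw [Nat.cast_one] at this
  exact memLp_one_iff_integrable.mp this

lemma Good.aem {f : Ω → ℝ} (hf : Good P f) : AEStronglyMeasurable f P := (hf 0).1

/-- Cauchy-Schwarz. -/
lemma cs {f g : Ω → ℝ} (hf : Good P f) (hg : Good P g) :
    (∫ x, f x * g x ∂P) ^ 2 ≤ (∫ x, f x ^ 2 ∂P) * (∫ x, g x ^ 2 ∂P) := by
  have key : ∀ t : ℝ, 0 ≤ (∫ x, g x ^ 2 ∂P) * (t * t) + (2 * ∫ x, f x * g x ∂P) * t
      + ∫ x, f x ^ 2 ∂P := by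
    intro t
    have h : ∫ x, (f x + t * g x) ^ 2 ∂P = (∫ x, g x ^ 2 ∂P) * (t * t)
        + (2 * ∫ x, f x * g x ∂P) * t + ∫ x, f x ^ 2 ∂P := by
      have : ∀ x, (f x + t * g x) ^ 2 = (t * t) * g x ^ 2 + (2 * t) * (f x * g x) + f x ^ 2 := by
        intro x; ring
      simp_rw [this]
      rw [integral_add (((hg.pow 2).const_mul _).add ((hf.mul hg).const_mul _)).int (hf.pow 2).int,
        integral_add ((hg.pow 2).const_mul _).int ((hf.mul hg).const_mul _).int,
        integral_const_mul, integral_const_mul]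
      ring
    rw [← h]
    exact integral_nonneg fun x => sq_nonneg _
  have := discrim_le_zero key
  unfold discrim at this
  nlinarith

lemma cs' {f g : Ω → ℝ} (hf : Good P f) (hg : Good P g) {a b : ℝ} (ha : 0 ≤ a) (hb : 0 ≤ b)
    (h1 : ∫ x, f x ^ 2 ∂P ≤ a ^ 2) (h2 : ∫ x, g x ^ 2 ∂P ≤ b ^ 2) :
    ∫ x, f x * g x ∂P ≤ a * b := by
  refine (abs_le_of_sq_le_sq' ?_ (by positivity)).2
  calc _ ≤ _ := cs hf hg
    _ ≤ a ^ 2 * b ^ 2 := mul_le_mul h1 h2 (integral_nonneg fun x => sq_nonneg _) (by positivity)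
    _ = _ := by ring

/-- The moment hypotheses on a single variable. -/
structure Mom (P : Measure Ω) (X : Ω → ℝ) (m M : ℝ) : Prop where
  good : Good P X
  one : 1 ≤ M
  e1 : ∫ x, X x ∂P = 0
  e2 : ∫ x, X x ^ 2 ∂P = m
  e2' : m ≤ M
  e4 : ∫ x, X x ^ 4 ∂P ≤ M
  f2 : ∫ x, (X x ^ 2 - m) ^ 2 ∂P ≤ M
  f4 : ∫ x, (X x ^ 2 - m) ^ 4 ∂P ≤ M

lemma indep_mul {α : Type*} [MeasurableSpace α] {Y : Ω → α} {X : Ω → ℝ}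
    (h : IndepFun Y X P) {u : α → ℝ} {w : ℝ → ℝ} (hu : Measurable u) (hw : Measurable w)
    (hgu : Good P (fun x => u (Y x))) (hgw : Good P (fun x => w (X x))) :
    ∫ x, u (Y x) * w (X x) ∂P = (∫ x, u (Y x) ∂P) * (∫ x, w (X x) ∂P) := by
  have := h.comp hu hw
  exact this.integral_fun_mul_eq_mul_integral hgu.aem hgw.aem

lemma pw_bound (u l x y c : ℝ) : (u + l * x + c * y) ^ 4 ≤
      u ^ 4 + 4 * ((u ^ 3 * l) * x) + (4 * c) * (u ^ 3 * y)
       + 16 * ((u ^ 2 * l ^ 2) * x ^ 2) + (16 * c ^ 2) * (u ^ 2 * y ^ 2)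
       + 24 * (l ^ 4 * x ^ 4) + (24 * c ^ 4) * y ^ 4 := by
  have h1 : ∀ u g : ℝ, (u + g) ^ 4 ≤ u ^ 4 + 4 * u ^ 3 * g + 8 * u ^ 2 * g ^ 2 + 3 * g ^ 4 := by
    intro u g
    nlinarith [sq_nonneg (u * g - g ^ 2)]
  have h2 : ∀ a b : ℝ, (a + b) ^ 2 ≤ 2 * a ^ 2 + 2 * b ^ 2 := by
    intro a b; nlinarith [sq_nonneg (a - b)]
  have h3 : ∀ a b : ℝ, (a + b) ^ 4 ≤ 8 * a ^ 4 + 8 * b ^ 4 := by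
    intro a b
    calc (a + b) ^ 4 = ((a + b) ^ 2) ^ 2 := by ring
      _ ≤ (2 * a ^ 2 + 2 * b ^ 2) ^ 2 := pow_le_pow_left₀ (sq_nonneg _) (h2 a b) 2
      _ ≤ _ := by nlinarith [sq_nonneg (a ^ 2 - b ^ 2)]
  have e1 := h1 u (l * x + c * y)
  have e3 := h3 (l * x) (c * y)
  have e4 := mul_le_mul_of_nonneg_left (h2 (l * x) (c * y)) (show 0 ≤ 8 * u ^ 2 by positivity)
  calc (u + l * x + c * y) ^ 4 = (u + (l * x + c * y)) ^ 4 := by ring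
    _ ≤ _ := e1
    _ ≤ _ := by linarith

set_option maxHeartbeats 1000000 in
lemma step {X U L : Ω → ℝ} {m M A B c : ℝ} (hX : Mom P X m M) (hU : Good P U) (hL : Good P L)
    (hind : IndepFun (fun x => (U x, L x)) X P) (hA : 0 ≤ A) (hB : 0 ≤ B)
    (hUA : ∫ x, U x ^ 4 ∂P ≤ A ^ 2) (hLB : ∫ x, L x ^ 4 ∂P ≤ B ^ 2) :
    ∫ x, (U x + L x * X x + c * (X x ^ 2 - m)) ^ 4 ∂P ≤ (A + 8 * M * (B + c ^ 2)) ^ 2 := by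
  have hM := hX.one
  have gX := hX.good
  have gη : Good P (fun x => X x ^ 2 - m) := (gX.pow 2).sub (Good.const m)
  have i1 : ∫ x, (U x ^ 3 * L x) * X x ∂P = 0 := by
    rw [indep_mul hind (u := fun y => y.1 ^ 3 * y.2) (w := fun t => t) (by fun_prop) (by fun_prop)
      ((hU.pow 3).mul hL) gX, hX.e1, mul_zero]
  have i2 : ∫ x, U x ^ 3 * (X x ^ 2 - m) ∂P = 0 := by
    rw [indep_mul hind (u := fun y => y.1 ^ 3) (w := fun t => t ^ 2 - m) (by fun_prop) (by fun_prop)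
      (hU.pow 3) gη, integral_sub (gX.pow 2).int (Good.const m).int, hX.e2]
    simp
  have i3 : ∫ x, (U x ^ 2 * L x ^ 2) * X x ^ 2 ∂P = (∫ x, U x ^ 2 * L x ^ 2 ∂P) * m := by
    rw [indep_mul hind (u := fun y => y.1 ^ 2 * y.2 ^ 2) (w := fun t => t ^ 2) (by fun_prop)
      (by fun_prop) ((hU.pow 2).mul (hL.pow 2)) (gX.pow 2), hX.e2]
  have i4 : ∫ x, U x ^ 2 * (X x ^ 2 - m) ^ 2 ∂P
      = (∫ x, U x ^ 2 ∂P) * ∫ x, (X x ^ 2 - m) ^ 2 ∂P :=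
    indep_mul hind (u := fun y => y.1 ^ 2) (w := fun t => (t ^ 2 - m) ^ 2) (by fun_prop)
      (by fun_prop) (hU.pow 2) (gη.pow 2)
  have i5 : ∫ x, L x ^ 4 * X x ^ 4 ∂P = (∫ x, L x ^ 4 ∂P) * ∫ x, X x ^ 4 ∂P :=
    indep_mul hind (u := fun y => y.2 ^ 4) (w := fun t => t ^ 4) (by fun_prop)
      (by fun_prop) (hL.pow 4) (gX.pow 4)
  have b1 : ∫ x, U x ^ 2 * L x ^ 2 ∂P ≤ A * B :=
    cs' (hU.pow 2) (hL.pow 2) hA hB (by simpa [← pow_mul] using hUA)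
      (by simpa [← pow_mul] using hLB)
  have b2 : ∫ x, U x ^ 2 ∂P ≤ A := by
    have := cs' (hU.pow 2) (Good.const (P := P) 1) hA zero_le_one (by simpa [← pow_mul] using hUA)
      (by simp)
    simpa using this
  have n1 : 0 ≤ ∫ x, U x ^ 2 * L x ^ 2 ∂P := integral_nonneg fun x => by positivity
  have n2 : 0 ≤ ∫ x, U x ^ 2 ∂P := integral_nonneg fun x => by positivity
  have n3 : 0 ≤ ∫ x, L x ^ 4 ∂P := integral_nonneg fun x => by positivity
  have n4 : 0 ≤ ∫ x, X x ^ 4 ∂P := integral_nonneg fun x => by positivity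
  have n5 : 0 ≤ ∫ x, (X x ^ 2 - m) ^ 2 ∂P := integral_nonneg fun x => by positivity
  have pw : ∀ x, (U x + L x * X x + c * (X x ^ 2 - m)) ^ 4 ≤
      U x ^ 4 + 4 * ((U x ^ 3 * L x) * X x) + (4 * c) * (U x ^ 3 * (X x ^ 2 - m))
       + 16 * ((U x ^ 2 * L x ^ 2) * X x ^ 2) + (16 * c ^ 2) * (U x ^ 2 * (X x ^ 2 - m) ^ 2)
       + 24 * (L x ^ 4 * X x ^ 4) + (24 * c ^ 4) * (X x ^ 2 - m) ^ 4 :=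
    fun x => pw_bound (U x) (L x) (X x) (X x ^ 2 - m) c
  have g1 := hU.pow 4
  have g2 := ((((hU.pow 3).mul hL).mul gX).const_mul 4)
  have g3 := (((hU.pow 3).mul gη).const_mul (4 * c))
  have g4 := ((((hU.pow 2).mul (hL.pow 2)).mul (gX.pow 2)).const_mul 16)
  have g5 := (((hU.pow 2).mul (gη.pow 2)).const_mul (16 * c ^ 2))
  have g6 := (((hL.pow 4).mul (gX.pow 4)).const_mul 24)
  have g7 := ((gη.pow 4).const_mul (24 * c ^ 4))
  have I := integral_mono (((hU.add (hL.mul gX)).add (gη.const_mul c)).pow 4).int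
    ((((((g1.add g2).add g3).add g4).add g5).add g6).add g7).int pw
  rw [integral_add (((((g1.add g2).add g3).add g4).add g5).add g6).int g7.int,
    integral_add ((((g1.add g2).add g3).add g4).add g5).int g6.int,
    integral_add (((g1.add g2).add g3).add g4).int g5.int,
    integral_add ((g1.add g2).add g3).int g4.int,
    integral_add (g1.add g2).int g3.int,
    integral_add g1.int g2.int] at I
  rw [integral_const_mul, integral_const_mul, integral_const_mul, integral_const_mul,
    integral_const_mul, integral_const_mul, i1, i2, i3, i4, i5] at I
  refine I.trans ?_
  have q1 : (∫ x, U x ^ 2 * L x ^ 2 ∂P) * m ≤ (A * B) * M := by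
    calc _ ≤ (∫ x, U x ^ 2 * L x ^ 2 ∂P) * M := mul_le_mul_of_nonneg_left hX.e2' n1
      _ ≤ _ := mul_le_mul_of_nonneg_right b1 (by linarith)
  have q2 : (∫ x, U x ^ 2 ∂P) * (∫ x, (X x ^ 2 - m) ^ 2 ∂P) ≤ A * M :=
    mul_le_mul b2 hX.f2 n5 hA
  have q3 : (∫ x, L x ^ 4 ∂P) * (∫ x, X x ^ 4 ∂P) ≤ B ^ 2 * M :=
    mul_le_mul hLB hX.e4 n4 (by positivity)
  have q2' := mul_le_mul_of_nonneg_left q2 (show 0 ≤ 16 * c ^ 2 by positivity)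
  have q4' := mul_le_mul_of_nonneg_left hX.f4 (show 0 ≤ 24 * c ^ 4 by positivity)
  have fin : 24 * M * (B ^ 2 + c ^ 4) ≤ 64 * M ^ 2 * (B + c ^ 2) ^ 2 := by
    have : 0 ≤ B * c ^ 2 := by positivity
    have h1 : B ^ 2 + c ^ 4 ≤ (B + c ^ 2) ^ 2 := by nlinarith
    have h2 : 24 * M ≤ 64 * M ^ 2 := by nlinarith
    exact mul_le_mul h2 h1 (by positivity) (by positivity)
  nlinarith

variable {ι : Type*} [DecidableEq ι]

lemma indep_tuple {X : ι → Ω → ℝ} (hi : iIndepFun X P) (hX : ∀ i, AEMeasurable (X i) P)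
    (s : Finset ι) (i : ι) (his : i ∉ s) :
    IndepFun (fun ω (j : s) => X j ω) (X i) P := by
  have := hi.indepFun_finset₀ s {i} (by simpa using his) hX
  have hm : Measurable (fun y : (({i} : Finset ι) → ℝ) => y ⟨i, by simp⟩) :=
    measurable_pi_apply _
  exact this.comp measurable_id hm

lemma linear_four {X : ι → Ω → ℝ} {m M : ℝ} (hi : iIndepFun X P)
    (hX : ∀ i, Mom P (X i) m M) (c : ι → ℝ) (s : Finset ι) :
    ∫ x, (∑ j ∈ s, c j * X j x) ^ 4 ∂P ≤ (8 * M * ∑ j ∈ s, c j ^ 2) ^ 2 := by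
  induction s using Finset.induction_on with
  | empty => simp
  | insert i s his ih =>
    have hM := (hX i).one
    have hind := indep_tuple hi (fun i => ((hX i).good.aem).aemeasurable) s i his
    have hU : Good P (fun x => ∑ j ∈ s, c j * X j x) :=
      Good.sum s (fun j _ => (hX j).good.const_mul _)
    have := step (c := 0) (hX i) hU (Good.const (c i))
      (by
        have := hind.comp (φ := fun y => (∑ j : s, c j * y j, c i)) (ψ := id)
          (by fun_prop) measurable_id
        rw [Function.id_comp] at this
        convert this using 2
        simp only [Function.comp]
        rw [Finset.sum_coe_sort s (fun j => c j * X j _)])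
      (by have : 0 ≤ ∑ j ∈ s, c j ^ 2 := Finset.sum_nonneg fun j _ => sq_nonneg _
          positivity) (sq_nonneg (c i)) ih (by simp; apply le_of_eq; ring)
    simp only [Finset.sum_insert his]
    convert this using 1
    · congr 1; ext x; ring
    · ring

lemma quad_four {X : ι → Ω → ℝ} {m M : ℝ} (hi : iIndepFun X P)
    (hX : ∀ i, Mom P (X i) m M) (a : ι → ι → ℝ) (ha : ∀ i j, a i j = a j i) (s : Finset ι) :
    ∫ x, (∑ i ∈ s, ∑ j ∈ s, a i j * (X i x * X j x) - m * ∑ i ∈ s, a i i) ^ 4 ∂P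
      ≤ (256 * M ^ 2 * ∑ i ∈ s, ∑ j ∈ s, a i j ^ 2) ^ 2 := by
  induction s using Finset.induction_on with
  | empty => simp
  | insert i s his ih =>
    have hM := (hX i).one
    have hind := indep_tuple hi (fun i => ((hX i).good.aem).aemeasurable) s i his
    have hU : Good P (fun x => ∑ i ∈ s, ∑ j ∈ s, a i j * (X i x * X j x) - m * ∑ i ∈ s, a i i) :=
      (Good.sum s (fun i _ => Good.sum s (fun j _ =>
        ((hX i).good.mul (hX j).good).const_mul _))).sub (Good.const _)
    have hL : Good P (fun x => ∑ j ∈ s, (2 * a i j) * X j x) :=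
      Good.sum s (fun j _ => (hX j).good.const_mul _)
    have hS : 0 ≤ ∑ i ∈ s, ∑ j ∈ s, a i j ^ 2 :=
      Finset.sum_nonneg fun i _ => Finset.sum_nonneg fun j _ => sq_nonneg _
    have hS' : 0 ≤ ∑ j ∈ s, (2 * a i j) ^ 2 := Finset.sum_nonneg fun j _ => sq_nonneg _
    have := step (c := a i i) (hX i) hU hL
      (by
        have := hind.comp (φ := fun y => (∑ i : s, ∑ j : s, a i j * (y i * y j)
          - m * ∑ i ∈ s, a i i, ∑ j : s, (2 * a i j) * y j)) (ψ := id)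
          (by fun_prop) measurable_id
        rw [Function.id_comp] at this
        convert this using 2
        simp only [Function.comp]
        rw [← Finset.sum_coe_sort s (fun j => 2 * a i j * X j _),
          ← Finset.sum_coe_sort s (fun i => ∑ j ∈ s, a i j * (X i _ * X j _))]
        congr 2
        apply Finset.sum_congr rfl
        intro k _
        rw [← Finset.sum_coe_sort s (fun j => a k j * (X k _ * X j _))])
      (by positivity) (by positivity) ih (linear_four hi hX (fun j => 2 * a i j) s)
    simp only [Finset.sum_insert his]
    refine le_trans (le_of_eq ?_) (this.trans ?_)
    · congr 1; ext x
      congr 1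
      simp only [Finset.sum_add_distrib]
      have e1 : ∑ k ∈ s, a k i * (X k x * X i x) = ∑ k ∈ s, a i k * (X i x * X k x) :=
        Finset.sum_congr rfl fun k _ => by rw [ha k i]; ring
      have e2 : (∑ j ∈ s, 2 * a i j * X j x) * X i x = 2 * ∑ k ∈ s, a i k * (X i x * X k x) := by
        rw [Finset.sum_mul, Finset.mul_sum]
        exact Finset.sum_congr rfl fun k _ => by ring
      rw [e1, e2]; ring
    · have e1 : ∑ k ∈ s, a k i ^ 2 = ∑ k ∈ s, a i k ^ 2 :=
        Finset.sum_congr rfl fun k _ => by rw [ha k i]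
      have e2 : ∑ j ∈ s, (2 * a i j) ^ 2 = 4 * ∑ k ∈ s, a i k ^ 2 := by
        rw [Finset.mul_sum]; exact Finset.sum_congr rfl fun k _ => by ring
      simp only [Finset.sum_add_distrib]
      rw [e1, e2]
      have n1 : 0 ≤ ∑ k ∈ s, a i k ^ 2 := Finset.sum_nonneg fun j _ => sq_nonneg _
      apply pow_le_pow_left₀ (by positivity)
      nlinarith [sq_nonneg (a i i), mul_nonneg (sq_nonneg M) n1,
        mul_nonneg (mul_nonneg (by linarith : (0:ℝ) ≤ M) (by linarith : (0:ℝ) ≤ M - 1)) (sq_nonneg (a i i)), mul_nonneg (sq_nonneg M) (sq_nonneg (a i i))]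

end Abstract


/-! ### The one dimensional law -/

section Law

/-- the unnormalised density -/
def wt (p t : ℝ) : ℝ := exp (-|t| ^ p)

/-- the derivative of `|t|^p / p` -/
def psi (p t : ℝ) : ℝ := Real.sign t * |t| ^ (p - 1)

/-- normalising constant -/
def ZZ (p : ℝ) : ℝ≥0∞ := ∫⁻ t, ENNReal.ofReal (wt p t)

/-- the probability measure with density proportional to `exp (-|t|^p)` -/
def gam (p : ℝ) : Measure ℝ := (ZZ p)⁻¹ • (volume.withDensity fun t => ENNReal.ofReal (wt p t))

lemma wt_pos (p t : ℝ) : 0 < wt p t := exp_pos _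

variable {p : ℝ}

lemma wt_cont (hp : 1 ≤ p) : Continuous (wt p) := by
  unfold wt
  exact (((continuous_abs.rpow_const (fun x => Or.inr (by linarith)))).neg).rexp

lemma integrable_abs_rpow_wt (hp : 1 ≤ p) {s : ℝ} (hs : 0 ≤ s) :
    Integrable (fun t => |t| ^ s * wt p t) := by
  have h0 := integrableOn_rpow_mul_exp_neg_rpow (p := p) (s := s) (by linarith) (by linarith)
  have h1 : IntegrableOn (fun t => |t| ^ s * wt p t) (Set.Ioi 0) := by
    refine h0.congr_fun (fun x hx => ?_) measurableSet_Ioi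
    simp only [wt, abs_of_pos (Set.mem_Ioi.mp hx)]
  have h2 : IntegrableOn (fun t => |t| ^ s * wt p t) (Set.Iic 0) := by
    rw [← integrableOn_Ici_iff_integrableOn_Ioi] at h1
    have := h1.comp_neg
    simpa [wt] using this
  rw [← integrableOn_univ, ← Set.Iic_union_Ioi (a := (0 : ℝ))]
  exact h2.union h1

lemma ZZ_eq (hp : 1 ≤ p) : ZZ p = ENNReal.ofReal (∫ t, wt p t) := by
  have := integrable_abs_rpow_wt hp le_rfl
  simp only [rpow_zero, one_mul] at this
  rw [ZZ, ofReal_integral_eq_lintegral_ofReal this (ae_of_all _ fun t => (wt_pos p t).le)]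

lemma Zint_pos (hp : 1 ≤ p) : 0 < ∫ t, wt p t := by
  have := integrable_abs_rpow_wt hp le_rfl
  simp only [rpow_zero, one_mul] at this
  exact integral_pos_of_integrable_nonneg_nonzero (x := 0) (wt_cont hp) this
    (fun t => (wt_pos p t).le) (wt_pos p 0).ne'

lemma ZZ_ne_zero (hp : 1 ≤ p) : ZZ p ≠ 0 := by
  rw [ZZ_eq hp]; simpa using Zint_pos hp

lemma ZZ_ne_top (hp : 1 ≤ p) : ZZ p ≠ ∞ := by
  rw [ZZ_eq hp]; simp

lemma gam_prob (hp : 1 ≤ p) : IsProbabilityMeasure (gam p) := by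
  constructor
  rw [gam, Measure.smul_apply, withDensity_apply _ MeasurableSet.univ, Measure.restrict_univ,
    smul_eq_mul]
  exact ENNReal.inv_mul_cancel (ZZ_ne_zero hp) (ZZ_ne_top hp)

lemma wt_meas (hp : 1 ≤ p) : Measurable fun t => ENNReal.ofReal (wt p t) :=
  (wt_cont hp).measurable.ennreal_ofReal

lemma integrable_gam (hp : 1 ≤ p) {f : ℝ → ℝ} (hf : Integrable (fun t => f t * wt p t)) :
    Integrable f (gam p) := by
  unfold gam
  apply Integrable.smul_measure _ (by simpa using ZZ_ne_zero hp)
  rw [integrable_withDensity_iff (wt_meas hp) (by simp)]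
  simpa [ENNReal.toReal_ofReal (wt_pos p _).le] using hf

lemma good_of_le (hp : 1 ≤ p) {f : ℝ → ℝ} (hfm : Measurable f) {s : ℝ} (hs : 0 ≤ s)
    (hf : ∀ t, |f t| ≤ |t| ^ s) : Good (gam p) f := by
  intro q
  rcases Nat.eq_zero_or_pos q with rfl | hq
  · simpa using hfm.aestronglyMeasurable
  rw [← integrable_norm_rpow_iff hfm.aestronglyMeasurable (by simpa using hq.ne') (by simp)]
  have h := integrable_gam hp (integrable_abs_rpow_wt hp (s := s * q) (by positivity))
  refine h.mono' ((hfm.norm.pow_const _).aestronglyMeasurable) (ae_of_all _ fun t => ?_)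
  simp only [ENNReal.toReal_natCast, norm_eq_abs]
  rw [abs_of_nonneg (by positivity), rpow_mul (abs_nonneg t)]
  exact rpow_le_rpow (abs_nonneg _) (hf t) (by positivity)

lemma good_id (hp : 1 ≤ p) : Good (gam p) (fun t => t) :=
  good_of_le hp measurable_id zero_le_one (by simp)

lemma sign_meas : Measurable Real.sign := by
  unfold Real.sign
  exact Measurable.ite measurableSet_Iio measurable_const
    (Measurable.ite measurableSet_Ioi measurable_const measurable_const)

lemma psi_meas : Measurable (psi p) := by
  unfold psi
  exact sign_meas.mul (by fun_prop)

lemma good_psi (hp : 1 ≤ p) : Good (gam p) (psi p) := by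
  refine good_of_le hp psi_meas (s := p - 1) (by linarith) fun t => ?_
  unfold psi
  rw [abs_mul, abs_of_nonneg (show 0 ≤ |t| ^ (p - 1) by positivity)]
  have : |Real.sign t| ≤ 1 := by
    rcases Real.sign_apply_eq t with h | h | h <;> rw [h] <;> simp
  nlinarith [show 0 ≤ |t| ^ (p - 1) by positivity]

lemma psi_neg (t : ℝ) : psi p (-t) = -psi p t := by
  unfold psi; rw [Real.sign_neg, abs_neg]; ring

lemma mul_psi (hp : 1 ≤ p) (t : ℝ) : t * psi p t = |t| ^ p := by
  unfold psi
  rcases eq_or_ne t 0 with rfl | h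
  · simp [zero_rpow (by linarith : p ≠ 0)]
  · have hs : t * Real.sign t = |t| := by
      rcases lt_or_gt_of_ne h with h | h
      · rw [Real.sign_of_neg h, abs_of_neg h]; ring
      · rw [Real.sign_of_pos h, abs_of_pos h]; ring
    rw [← mul_assoc, hs]
    rw [← rpow_one_add' (abs_nonneg t) (by linarith)]
    congr 1; ring

lemma gam_neg (hp : 1 ≤ p) (f : ℝ → ℝ) : ∫ t, f (-t) ∂(gam p) = ∫ t, f t ∂(gam p) := by
  have key : ∀ g : ℝ → ℝ, ∫ t, g t ∂(gam p) = (ZZ p)⁻¹.toReal * ∫ t, wt p t * g t := by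
    intro g
    rw [gam, integral_smul_measure, integral_withDensity_eq_integral_toReal_smul (wt_meas hp)
      (by simp)]
    simp [ENNReal.toReal_ofReal (wt_pos p _).le]
  rw [key, key, ← integral_neg_eq_self (fun t => wt p t * f t)]
  simp [wt]

lemma gam_odd (hp : 1 ≤ p) {f : ℝ → ℝ} (hf : ∀ t, f (-t) = -f t) : ∫ t, f t ∂(gam p) = 0 := by
  have := gam_neg hp f
  simp_rw [hf, integral_neg] at this
  linarith

lemma gam_openPos (hp : 1 ≤ p) : (gam p).IsOpenPosMeasure := by
  apply Measure.AbsolutelyContinuous.isOpenPosMeasure (μ := (volume : Measure ℝ))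
  unfold gam
  refine Measure.AbsolutelyContinuous.trans ?_
    (Measure.AbsolutelyContinuous.rfl.smul_right (by simpa using ZZ_ne_top hp))
  exact withDensity_absolutelyContinuous' (wt_meas hp).aemeasurable
    (ae_of_all _ fun t => by simpa using wt_pos p t)

/-- second moments -/
def m2 (p : ℝ) : ℝ := ∫ t, t ^ 2 ∂(gam p)
def mpsi (p : ℝ) : ℝ := ∫ t, psi p t ^ 2 ∂(gam p)
def mx (p : ℝ) : ℝ := ∫ t, t * psi p t ∂(gam p)
def mxx (p : ℝ) : ℝ := ∫ t, t ^ 2 * psi p t ^ 2 ∂(gam p)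

lemma mx_pos (hp : 1 ≤ p) : 0 < mx p := by
  have := gam_openPos hp
  have := gam_prob hp
  have h := ((good_id hp).mul (good_psi hp)).int
  unfold mx
  simp_rw [mul_psi hp] at h ⊢
  exact integral_pos_of_integrable_nonneg_nonzero (x := 1)
    (continuous_abs.rpow_const (fun x => Or.inr (by linarith))) h
    (fun t => by positivity) (by simp)

lemma mx_sq_le (hp : 1 ≤ p) : mx p ^ 2 ≤ m2 p * mpsi p := by
  have := gam_prob hp
  exact cs (good_id hp) (good_psi hp)

lemma mx_sq_lt (hp : 1 ≤ p) : mx p ^ 2 < mxx p := by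
  have := gam_openPos hp
  have := gam_prob hp
  have g := (good_id hp).mul (good_psi hp)
  have gc := g.sub (Good.const (mx p))
  have h : 0 < ∫ t, (t * psi p t - mx p) ^ 2 ∂(gam p) := by
    have hi := (gc.pow 2).int
    simp_rw [mul_psi hp] at hi ⊢
    refine integral_pos_of_integrable_nonneg_nonzero (x := 0) ?_ hi
      (fun t => by positivity) ?_
    · exact ((continuous_abs.rpow_const (fun x => Or.inr (by linarith))).sub
        continuous_const).pow 2
    · simp [zero_rpow (by linarith : p ≠ 0), (mx_pos hp).ne']
  have e : ∫ t, (t * psi p t - mx p) ^ 2 ∂(gam p) = mxx p - mx p ^ 2 := by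
    have : ∀ t, (t * psi p t - mx p) ^ 2 =
        t ^ 2 * psi p t ^ 2 - (2 * mx p) * (t * psi p t) + mx p ^ 2 := by intro t; ring
    simp_rw [this]
    rw [integral_add ((((good_id hp).pow 2).mul ((good_psi hp).pow 2)).sub (g.const_mul _)).int
      (Good.const _).int, integral_sub (((good_id hp).pow 2).mul ((good_psi hp).pow 2)).int
      (g.const_mul _).int, integral_const_mul]
    simp [mxx, mx]; ring
  linarith

lemma prod_pos (hp : 1 ≤ p) : 0 < m2 p * mpsi p :=
  lt_of_lt_of_le (pow_pos (mx_pos hp) 2) (mx_sq_le hp)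

/-- the measure on the product -/
def PP (p : ℝ) (n : ℕ) : Measure (Fin n → ℝ) := Measure.pi fun _ => gam p

lemma PP_prob (hp : 1 ≤ p) (n : ℕ) : IsProbabilityMeasure (PP p n) := by
  have := gam_prob hp
  unfold PP; infer_instance

lemma PP_eval (hp : 1 ≤ p) (n : ℕ) (i : Fin n) :
    MeasurePreserving (fun x : Fin n → ℝ => x i) (PP p n) (gam p) := by
  have := gam_prob hp
  exact measurePreserving_eval (fun _ : Fin n => gam p) i

lemma PP_int (hp : 1 ≤ p) (n : ℕ) (i : Fin n) {f : ℝ → ℝ} (hf : Good (gam p) f) :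
    ∫ x, f (x i) ∂(PP p n) = ∫ t, f t ∂(gam p) := by
  have h := PP_eval hp n i
  have := gam_prob hp
  rw [← h.map_eq, integral_map h.measurable.aemeasurable (by rw [h.map_eq]; exact hf.aem)]

lemma PP_good (hp : 1 ≤ p) (n : ℕ) (i : Fin n) {f : ℝ → ℝ} (hf : Good (gam p) f) :
    Good (PP p n) (fun x => f (x i)) := by
  have := gam_prob hp
  exact fun q => (hf q).comp_measurePreserving (PP_eval hp n i)

lemma PP_indep (hp : 1 ≤ p) (n : ℕ) {f : ℝ → ℝ} (hf : Measurable f) :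
    iIndepFun (fun i (x : Fin n → ℝ) => f (x i)) (PP p n) := by
  have := gam_prob hp
  exact iIndepFun_pi (μ := fun _ : Fin n => gam p) (X := fun _ => f) (fun _ => hf.aemeasurable)

/-- volume with product density is the (scaled) product measure -/
lemma PP_eq (hp : 1 ≤ p) (n : ℕ) :
    (volume : Measure (Fin n → ℝ)).withDensity (fun x => ENNReal.ofReal (∏ i, wt p (x i)))
      = (ZZ p) ^ n • PP p n := by
  have hprob := gam_prob hp
  have hw : Integrable (wt p) := by
    have := integrable_abs_rpow_wt hp le_rfl
    simpa only [rpow_zero, one_mul] using this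
  have e : PP p n = ((ZZ p) ^ n)⁻¹ • 
      (volume : Measure (Fin n → ℝ)).withDensity (fun x => ENNReal.ofReal (∏ i, wt p (x i))) := by
    unfold PP
    symm
    refine (Measure.pi_eq (μ := fun _ : Fin n => gam p) (fun s hs => ?_)).symm
    rw [Measure.smul_apply, withDensity_apply _ (MeasurableSet.univ_pi hs), volume_pi,
      Measure.restrict_pi_pi, ← ofReal_integral_eq_lintegral_ofReal,
      integral_fintype_prod_eq_prod (fun _ => wt p), ENNReal.ofReal_prod_of_nonneg]
    · have : ∀ i, gam p (s i) = (ZZ p)⁻¹ * ENNReal.ofReal (∫ t in s i, wt p t) := by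
        intro i
        rw [gam, Measure.smul_apply, withDensity_apply _ (hs i), smul_eq_mul,
          ofReal_integral_eq_lintegral_ofReal hw.integrableOn
            (ae_of_all _ fun t => (wt_pos p t).le)]
      simp_rw [this]
      rw [Finset.prod_mul_distrib, smul_eq_mul]
      simp [ENNReal.inv_pow]
    · intro i _
      exact integral_nonneg fun t => (wt_pos p t).le
    · exact Integrable.fintype_prod (f := fun _ => wt p) (fun i => hw.integrableOn)
    · exact ae_of_all _ fun x => Finset.prod_nonneg fun i _ => (wt_pos p _).le
  rw [e, smul_smul, ENNReal.mul_inv_cancel, one_smul]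
  · exact pow_ne_zero _ (ZZ_ne_zero hp)
  · exact ENNReal.pow_ne_top (ZZ_ne_top hp)

end Law


/-! ### Core estimates -/

section Core

variable {p : ℝ}

lemma exists_mom (hp : 1 ≤ p) {f : ℝ → ℝ} (hf : Good (gam p) f) (hodd : ∀ t, f (-t) = -f t) :
    ∃ M : ℝ, ∀ M' : ℝ, M ≤ M' → ∀ n : ℕ, ∀ i : Fin n,
      Mom (PP p n) (fun x => f (x i)) (∫ t, f t ^ 2 ∂(gam p)) M' := by
  have := gam_prob hp
  set m := ∫ t, f t ^ 2 ∂(gam p) with hm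
  have g2 : Good (gam p) (fun t => f t ^ 2 - m) := (hf.pow 2).sub (Good.const m)
  have n1 : 0 ≤ m := integral_nonneg fun t => sq_nonneg _
  have n2 : 0 ≤ ∫ t, f t ^ 4 ∂(gam p) := integral_nonneg fun t => by positivity
  have n3 : 0 ≤ ∫ t, (f t ^ 2 - m) ^ 2 ∂(gam p) := integral_nonneg fun t => by positivity
  have n4 : 0 ≤ ∫ t, (f t ^ 2 - m) ^ 4 ∂(gam p) := integral_nonneg fun t => by positivity
  refine ⟨1 + m + (∫ t, f t ^ 4 ∂(gam p)) + (∫ t, (f t ^ 2 - m) ^ 2 ∂(gam p)) +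
    (∫ t, (f t ^ 2 - m) ^ 4 ∂(gam p)), fun M' hM n i => ?_⟩
  have i1 := PP_int hp n i hf
  have i2 := PP_int hp n i (hf.pow 2)
  have i3 := PP_int hp n i (hf.pow 4)
  have i4 := PP_int hp n i (g2.pow 2)
  have i5 := PP_int hp n i (g2.pow 4)
  exact ⟨PP_good hp n i hf, by linarith, by rw [i1]; exact gam_odd hp hodd, i2, by linarith,
    by rw [i3]; linarith, by rw [i4]; linarith, by rw [i5]; linarith⟩

/-- the sum of the derivatives -/
def SS (p : ℝ) {n : ℕ} (x : Fin n → ℝ) : ℝ := ∑ i, psi p (x i)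

lemma SS_meas {n : ℕ} : Measurable (SS p : (Fin n → ℝ) → ℝ) := by
  unfold SS
  exact Finset.measurable_sum _ fun i _ => psi_meas.comp (measurable_pi_apply i)

lemma good_x (hp : 1 ≤ p) {n : ℕ} (i : Fin n) : Good (PP p n) (fun x => x i) :=
  PP_good hp n i (good_id hp)

lemma good_px (hp : 1 ≤ p) {n : ℕ} (i : Fin n) : Good (PP p n) (fun x => psi p (x i)) :=
  PP_good hp n i (good_psi hp)

lemma good_SS (hp : 1 ≤ p) {n : ℕ} : Good (PP p n) (SS p) := by
  have := PP_prob hp n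
  exact Good.sum _ fun i _ => good_px hp i

/-- expectation of a product of functions of two distinct coordinates -/
lemma pair_int (hp : 1 ≤ p) {n : ℕ} {i j : Fin n} (hij : i ≠ j) {u v : ℝ → ℝ}
    (hu : Measurable u) (hv : Measurable v) (gu : Good (gam p) u) (gv : Good (gam p) v) :
    ∫ x, u (x i) * v (x j) ∂(PP p n) = (∫ t, u t ∂(gam p)) * ∫ t, v t ∂(gam p) := by
  have := PP_prob hp n
  have h := (PP_indep hp n measurable_id).indepFun hij
  have := indep_mul (P := PP p n) h hu hv (PP_good hp n i gu) (PP_good hp n j gv)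
  simp only [id] at this
  rw [this, PP_int hp n i gu, PP_int hp n j gv]

lemma sum_psi_sq (hp : 1 ≤ p) {n : ℕ} (s : Finset (Fin n)) :
    ∫ x, (∑ k ∈ s, psi p (x k)) ^ 2 ∂(PP p n) = s.card * mpsi p := by
  have := PP_prob hp n
  have := gam_prob hp
  simp_rw [sq, Finset.sum_mul_sum]
  rw [integral_finsetSum _ fun k _ => (Good.sum _ fun l _ => (good_px hp k).mul (good_px hp l)).int]
  have : ∀ k ∈ s, ∫ x, ∑ l ∈ s, psi p (x k) * psi p (x l) ∂(PP p n) = mpsi p := by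
    intro k hk
    rw [integral_finsetSum _ fun l _ => ((good_px hp k).mul (good_px hp l)).int,
      Finset.sum_eq_single_of_mem k hk]
    · have := PP_int hp n k ((good_psi hp).pow 2)
      rw [mpsi, ← this]; simp_rw [sq]
    · intro l _ hl
      rw [pair_int hp hl.symm psi_meas psi_meas (good_psi hp) (good_psi hp),
        gam_odd hp psi_neg, zero_mul]
  rw [Finset.sum_congr rfl this]; simp

lemma SS_sq (hp : 1 ≤ p) {n : ℕ} : ∫ x, SS p x ^ 2 ∂(PP p n) = n * mpsi p := by
  have := sum_psi_sq hp (n := n) Finset.univ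
  simpa [SS] using this

lemma sum_psi_int (hp : 1 ≤ p) {n : ℕ} (s : Finset (Fin n)) :
    ∫ x, (∑ k ∈ s, psi p (x k)) ∂(PP p n) = 0 := by
  have := PP_prob hp n
  rw [integral_finsetSum _ fun k _ => (good_px hp k).int]
  apply Finset.sum_eq_zero
  intro k _
  rw [PP_int hp n k (good_psi hp), gam_odd hp psi_neg]

lemma f_int (hp : 1 ≤ p) {n : ℕ} {i j : Fin n} (hij : i ≠ j) :
    ∫ x, (x i - x j) ^ 2 / 2 ∂(PP p n) = m2 p := by
  have := PP_prob hp n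
  have := gam_prob hp
  have e : ∀ x : Fin n → ℝ, (x i - x j) ^ 2 / 2 = (1/2) * (x i)^2 + (-1) * (x i * x j)
     + (1/2) * (x j)^2 := by intro x; ring
  simp_rw [e]
  have g1 := (good_x hp i).pow 2
  have g2 := (good_x hp j).pow 2
  have g3 := (good_x hp i).mul (good_x hp j)
  rw [integral_add ((g1.const_mul _).add (g3.const_mul _)).int (g2.const_mul _).int,
    integral_add (g1.const_mul _).int (g3.const_mul _).int, integral_const_mul, integral_const_mul,
    integral_const_mul, PP_int hp n i ((good_id hp).pow 2), PP_int hp n j ((good_id hp).pow 2),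
    pair_int (u := fun t => t) (v := fun t => t) hp hij measurable_id measurable_id (good_id hp) (good_id hp)]
  have := gam_odd hp (f := fun t => t) (fun t => rfl)
  simp only [id, this, m2]; ring

lemma fA_int (hp : 1 ≤ p) {n : ℕ} {i j : Fin n} (hij : i ≠ j) :
    ∫ x, (x i - x j) ^ 2 / 2 * (psi p (x i) + psi p (x j)) ^ 2 ∂(PP p n)
      = mxx p + m2 p * mpsi p - 2 * mx p ^ 2 := by
  have := PP_prob hp n
  have hgp := gam_prob hp
  set g : (Fin n → ℝ) → ℝ := fun x => (x i * psi p (x i) - x j * psi p (x j)) +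
    (x i * psi p (x j) - x j * psi p (x i)) with hg
  have hu : ∀ a b : ℕ, Measurable fun t => t ^ a * psi p t ^ b := fun a b =>
    (measurable_id.pow_const a).mul (psi_meas.pow_const b)
  have gu : ∀ a b : ℕ, Good (gam p) fun t => t ^ a * psi p t ^ b := fun a b =>
    ((good_id hp).pow a).mul ((good_psi hp).pow b)
  set mm : ℕ → ℕ → ℝ := fun a b => ∫ t, t ^ a * psi p t ^ b ∂(gam p) with hmm
  have key : ∀ a b c d, ∫ x, (x i ^ a * psi p (x i) ^ b) * (x j ^ c * psi p (x j) ^ d) ∂(PP p n)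
      = mm a b * mm c d := fun a b c d => pair_int hp hij (hu a b) (hu c d) (gu a b) (gu c d)
  have z21 : mm 2 1 = 0 := gam_odd hp fun t => by rw [psi_neg]; ring
  have z01 : mm 0 1 = 0 := gam_odd hp fun t => by rw [psi_neg]; ring
  have z10 : mm 1 0 = 0 := gam_odd hp fun t => by rw [psi_neg]; ring
  have z12 : mm 1 2 = 0 := gam_odd hp fun t => by rw [psi_neg]; ring
  have z00 : mm 0 0 = 1 := by simp [hmm]
  have z11 : mm 1 1 = mx p := by simp [hmm, mx]
  have z22 : mm 2 2 = mxx p := by simp [hmm, mxx]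
  have z20 : mm 2 0 = m2 p := by simp [hmm, m2]
  have z02 : mm 0 2 = mpsi p := by simp [hmm, mpsi]
  set T : Fin 9 → ℝ × ℕ × ℕ × ℕ × ℕ := ![(1/2, 2, 2, 0, 0), (1, 2, 1, 0, 1), (1/2, 2, 0, 0, 2),
    (-1, 1, 2, 1, 0), (-2, 1, 1, 1, 1), (-1, 1, 0, 1, 2), (1/2, 0, 2, 2, 0), (1, 0, 1, 2, 1),
    (1/2, 0, 0, 2, 2)] with hT
  have e : ∀ x : Fin n → ℝ, (x i - x j) ^ 2 / 2 * (psi p (x i) + psi p (x j)) ^ 2 =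
      ∑ k, (T k).1 * ((x i ^ (T k).2.1 * psi p (x i) ^ (T k).2.2.1) *
        (x j ^ (T k).2.2.2.1 * psi p (x j) ^ (T k).2.2.2.2)) := by
    intro x
    simp [hT, Fin.sum_univ_succ]
    ring
  simp_rw [e]
  rw [integral_finsetSum]
  · simp_rw [integral_const_mul, key]
    simp [hT, Fin.sum_univ_succ, z21, z01, z10, z12, z00, z11, z22, z20, z02]
    ring
  · intro k _
    exact (((PP_good hp n i (gu _ _)).mul (PP_good hp n j (gu _ _))).const_mul _).int

lemma fSS_int (hp : 1 ≤ p) {n : ℕ} {i j : Fin n} (hij : i ≠ j) :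
    ∫ x, (x i - x j) ^ 2 / 2 * SS p x ^ 2 ∂(PP p n)
      = mxx p + m2 p * mpsi p - 2 * mx p ^ 2 + (n - 2) * (m2 p * mpsi p) := by
  have := PP_prob hp n
  set s : Finset (Fin n) := {i, j} with hs
  set R : (Fin n → ℝ) → ℝ := fun x => ∑ k ∈ sᶜ, psi p (x k) with hR
  set A : (Fin n → ℝ) → ℝ := fun x => psi p (x i) + psi p (x j) with hA
  set f : (Fin n → ℝ) → ℝ := fun x => (x i - x j) ^ 2 / 2 with hf
  have hS : ∀ x, SS p x = A x + R x := by
    intro x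
    rw [SS, ← Finset.sum_add_sum_compl s, hs, Finset.sum_pair hij]
  have gR : Good (PP p n) R := Good.sum _ fun k _ => good_px hp k
  have gA : Good (PP p n) A := (good_px hp i).add (good_px hp j)
  have gf : Good (PP p n) f := by
    have := (((good_x hp i).sub (good_x hp j)).pow 2).const_mul (1/2)
    convert this using 2; simp only [hf]; ring
  have hind := (PP_indep hp n measurable_id).indepFun_finset₀ s sᶜ disjoint_compl_right
    (fun k => (measurable_pi_apply k).aemeasurable)
  have is : i ∈ s := by simp [hs]
  have js : j ∈ s := by simp [hs]
  have hRm : Measurable fun y : (sᶜ : Finset (Fin n)) → ℝ => ∑ k, psi p (y k) :=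
    Finset.measurable_sum _ fun k _ => psi_meas.comp (measurable_pi_apply k)
  have hRe : ∀ x : Fin n → ℝ, ∑ k : (sᶜ : Finset (Fin n)), psi p (x k) = R x := fun x => by
    rw [hR, Finset.sum_coe_sort sᶜ (fun k => psi p (x k))]
  have hfm : Measurable fun y : s → ℝ => (y ⟨i, is⟩ - y ⟨j, js⟩) ^ 2 / 2 := by fun_prop
  have hAm : Measurable fun y : s → ℝ => psi p (y ⟨i, is⟩) + psi p (y ⟨j, js⟩) :=
    (psi_meas.comp (measurable_pi_apply _)).add (psi_meas.comp (measurable_pi_apply _))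
  have e1 : ∫ x, f x * A x * R x ∂(PP p n) = 0 := by
    have := (hind.comp (hfm.mul hAm) hRm).integral_fun_mul_eq_mul_integral
      (gf.mul gA).aem
      (by simpa only [Function.comp_def, id, hRe] using gR.aem)
    simp only [Function.comp_def, id, hRe, Pi.mul_apply] at this
    refine Eq.trans this ?_
    rw [hR, sum_psi_int hp, mul_zero]
  have e2 : ∫ x, f x * R x ^ 2 ∂(PP p n) = m2 p * ((n - 2) * mpsi p) := by
    have := (hind.comp hfm (hRm.pow_const 2)).integral_fun_mul_eq_mul_integral
      (by simpa only [Function.comp_def, id, hRe] using gf.aem)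
      (by simpa only [Function.comp_def, id, hRe] using (gR.pow 2).aem)
    simp only [Function.comp_def, id, hRe] at this
    refine Eq.trans this ?_
    rw [f_int hp hij, hR, sum_psi_sq hp, Finset.card_compl, Nat.cast_sub (Finset.card_le_univ _),
      hs, Finset.card_pair hij]
    simp
  have e : ∀ x, f x * SS p x ^ 2 = f x * A x ^ 2 + 2 * (f x * A x * R x) + f x * R x ^ 2 := by
    intro x; rw [hS]; ring
  change ∫ x, f x * SS p x ^ 2 ∂(PP p n) = _
  simp_rw [e]
  rw [integral_add ((gf.mul (gA.pow 2)).add (((gf.mul gA).mul gR).const_mul 2)).int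
    (gf.mul (gR.pow 2)).int, integral_add (gf.mul (gA.pow 2)).int
    (((gf.mul gA).mul gR).const_mul 2).int, integral_const_mul, e1, e2, fA_int hp hij]
  ring

end Core


section Core2

variable {p : ℝ}

/-- the quadratic form -/
def QQ {n : ℕ} (a : Fin n → Fin n → ℝ) (x : Fin n → ℝ) : ℝ := ∑ i, ∑ j, a i j * (x i * x j)

lemma good_QQ (hp : 1 ≤ p) {n : ℕ} (a : Fin n → Fin n → ℝ) : Good (PP p n) (QQ a) := by
  have := PP_prob hp n
  exact Good.sum _ fun i _ => Good.sum _ fun j _ => ((good_x hp i).mul (good_x hp j)).const_mul _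

lemma SS_eight (hp : 1 ≤ p) {M : ℝ} {n : ℕ}
    (hM : ∀ i : Fin n, Mom (PP p n) (fun x => psi p (x i)) (mpsi p) M) (hn : 1 ≤ n) :
    ∫ x, SS p x ^ 8 ∂(PP p n) ≤ (1024 * M ^ 2 * n ^ 2) ^ 2 := by
  have := PP_prob hp n
  have hq := quad_four (PP_indep hp n psi_meas) hM (fun _ _ => 1) (fun _ _ => rfl) Finset.univ
  have e : ∀ x : Fin n → ℝ, ∑ i, ∑ j, (1 : ℝ) * (psi p (x i) * psi p (x j)) = SS p x ^ 2 := by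
    intro x; simp only [one_mul, SS, sq, Finset.sum_mul_sum]
  simp only [e] at hq
  simp at hq
  have hM1 := (hM ⟨0, hn⟩).one
  have hm := (hM ⟨0, hn⟩).e2'
  have hm0 : 0 ≤ mpsi p := integral_nonneg fun t => sq_nonneg _
  have g := good_SS (n := n) hp
  have g2 : Good (PP p n) (fun x => (SS p x ^ 2 - mpsi p * n) ^ 4) :=
    ((g.pow 2).sub (Good.const _)).pow 4
  calc ∫ x, SS p x ^ 8 ∂(PP p n) 
      ≤ ∫ x, (8 * (SS p x ^ 2 - mpsi p * n) ^ 4 + 8 * (mpsi p * n) ^ 4) ∂(PP p n) := by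
        refine integral_mono (g.pow 8).int ((g2.const_mul 8).add (Good.const _)).int fun x => ?_
        have key : ∀ a b : ℝ, (a + b) ^ 4 ≤ 8 * a ^ 4 + 8 * b ^ 4 := by
          intro a b
          nlinarith [sq_nonneg (a ^ 2 - b ^ 2), sq_nonneg (a - b), sq_nonneg ((a - b) ^ 2),
            sq_nonneg (a ^ 2 - a * b), sq_nonneg (b ^ 2 - a * b), sq_nonneg ((a-b)*(a+b))]
        have := key (SS p x ^ 2 - mpsi p * n) (mpsi p * n)
        calc SS p x ^ 8 = (SS p x ^ 2 - mpsi p * n + mpsi p * n) ^ 4 := by ring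
          _ ≤ _ := this
    _ = 8 * (∫ x, (SS p x ^ 2 - mpsi p * n) ^ 4 ∂(PP p n)) + 8 * (mpsi p * n) ^ 4 := by
        rw [integral_add (g2.const_mul 8).int (Good.const _).int, integral_const_mul]
        simp
    _ ≤ 8 * (256 * M ^ 2 * (n * n)) ^ 2 + 8 * (M * n) ^ 4 := by gcongr
    _ ≤ _ := by
        have : (0:ℝ) ≤ M ^ 4 * n ^ 4 := by positivity
        nlinarith

lemma tau_lower (hp : 1 ≤ p) {M : ℝ} 
    (hM : ∀ n, ∀ i : Fin n, Mom (PP p n) (fun x => psi p (x i)) (mpsi p) M)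
    (hM' : ∀ n, ∀ i : Fin n, Mom (PP p n) (fun x => x i) (m2 p) M) :
    ∃ c : ℝ, 0 < c ∧ ∀ n : ℕ, 2 ≤ n → ∀ i j : Fin n, i ≠ j →
      c * √n ≤ ∫ x, (x i - x j) ^ 2 / 2 * |SS p x| ∂(PP p n) := by
  have hM1 : 1 ≤ M := (hM 1 0).one
  set k : ℝ := min (mxx p + m2 p * mpsi p - 2 * mx p ^ 2) (m2 p * mpsi p) with hk
  have kpos : 0 < k := lt_min (by linarith [mx_sq_le hp, mx_sq_lt hp]) (prod_pos hp)
  set K := √(8192 * M ^ 3 / k) with hK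
  have K2 : K ^ 2 = 8192 * M ^ 3 / k := Real.sq_sqrt (by positivity)
  have Kpos : 0 < K := Real.sqrt_pos.mpr (by positivity)
  refine ⟨k / (4 * K), by positivity, fun n hn i j hij => ?_⟩
  have := PP_prob hp n
  have hn' : (2 : ℝ) ≤ n := by exact_mod_cast hn
  have sn : 0 < √(n : ℝ) := Real.sqrt_pos.mpr (by linarith)
  have sn2 : √(n : ℝ) ^ 2 = n := Real.sq_sqrt (by linarith)
  have gS := good_SS (n := n) hp
  have gf : Good (PP p n) (fun x => (x i - x j) ^ 2 / 2) := by
    have := (((good_x hp i).sub (good_x hp j)).pow 2).const_mul (1/2)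
    convert this using 2; ring
  set t := K * √n with ht
  have tpos : 0 < t := by positivity
  have h4 : ∀ i : Fin n, ∫ x, x i ^ 2 * SS p x ^ 4 ∂(PP p n) ≤ M * (1024 * M ^ 2 * n ^ 2) := by
    intro i
    refine cs' ((good_x hp i).pow 2) (gS.pow 4) (by linarith) (by positivity) ?_ ?_
    · have := (hM' n i).e4
      calc _ = ∫ x, x i ^ 4 ∂(PP p n) := by congr 1; ext x; ring
        _ ≤ M := this
        _ ≤ _ := by nlinarith
    · calc _ = ∫ x, SS p x ^ 8 ∂(PP p n) := by congr 1; ext x; ring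
        _ ≤ _ := SS_eight hp (hM n) (by omega)
  have h2 : k * n / 2 ≤ ∫ x, (x i - x j) ^ 2 / 2 * SS p x ^ 2 ∂(PP p n) := by
    rw [fSS_int hp hij]
    have h1 : k ≤ mxx p + m2 p * mpsi p - 2 * mx p ^ 2 := min_le_left _ _
    have h2 : k ≤ m2 p * mpsi p := min_le_right _ _
    nlinarith
  have hlow : ∫ x, ((1 / t) * ((x i - x j) ^ 2 / 2 * SS p x ^ 2) -
      ((1 / t ^ 3) * (x i ^ 2 * SS p x ^ 4) + (1 / t ^ 3) * (x j ^ 2 * SS p x ^ 4))) ∂(PP p n)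
      ≤ ∫ x, (x i - x j) ^ 2 / 2 * |SS p x| ∂(PP p n) := by
    refine integral_mono (((gf.mul (gS.pow 2)).const_mul _).sub
      (((((good_x hp i).pow 2).mul (gS.pow 4)).const_mul _).add
      ((((good_x hp j).pow 2).mul (gS.pow 4)).const_mul _))).int (gf.mul gS.abs).int fun x => ?_
    have hs : SS p x ^ 2 / t - SS p x ^ 4 / t ^ 3 ≤ |SS p x| := by
      rw [← sq_abs, show SS p x ^ 4 = |SS p x| ^ 4 by rw [pow_abs, abs_of_nonneg (by positivity)]]
      set s := |SS p x| with hs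
      have s0 : 0 ≤ s := abs_nonneg _
      rw [div_sub_div _ _ (by positivity) (by positivity), div_le_iff₀ (by positivity)]
      have h : s * t ^ 2 - s ^ 3 ≤ t ^ 3 ∨ True := Or.inr trivial
      have : s * t ^ 2 ≤ t ^ 3 + s ^ 3 := by
        nlinarith [mul_nonneg (add_nonneg s0 tpos.le) (sq_nonneg (s - t)), mul_nonneg s0 (sq_nonneg (s - t)), mul_nonneg tpos.le (sq_nonneg (s - t)), pow_nonneg s0 3, pow_pos tpos 3]
      nlinarith [mul_le_mul_of_nonneg_left this (mul_nonneg s0 tpos.le)]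
    have hf : (x i - x j) ^ 2 / 2 ≤ x i ^ 2 + x j ^ 2 := by nlinarith [sq_nonneg (x i + x j)]
    have h0 : 0 ≤ SS p x ^ 4 / t ^ 3 := by positivity
    have := mul_le_mul_of_nonneg_left hs (show 0 ≤ (x i - x j) ^ 2 / 2 by positivity)
    have h3 := mul_le_mul_of_nonneg_right hf h0
    calc _ = (x i - x j) ^ 2 / 2 * (SS p x ^ 2 / t) - (x i ^ 2 + x j ^ 2) * (SS p x ^ 4 / t ^ 3) := by
          ring
      _ ≤ (x i - x j) ^ 2 / 2 * (SS p x ^ 2 / t) - (x i - x j) ^ 2 / 2 * (SS p x ^ 4 / t ^ 3) := by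
          linarith
      _ ≤ _ := by linarith
  rw [integral_sub ((gf.mul (gS.pow 2)).const_mul _).int
      (((((good_x hp i).pow 2).mul (gS.pow 4)).const_mul _).add
      ((((good_x hp j).pow 2).mul (gS.pow 4)).const_mul _)).int,
      integral_add ((((good_x hp i).pow 2).mul (gS.pow 4)).const_mul _).int
      ((((good_x hp j).pow 2).mul (gS.pow 4)).const_mul _).int, integral_const_mul,
      integral_const_mul, integral_const_mul] at hlow
  refine le_trans ?_ hlow
  have a1 := mul_le_mul_of_nonneg_left h2 (show 0 ≤ 1 / t by positivity)
  have a2 := mul_le_mul_of_nonneg_left (h4 i) (show 0 ≤ 1 / t ^ 3 by positivity)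
  have a3 := mul_le_mul_of_nonneg_left (h4 j) (show 0 ≤ 1 / t ^ 3 by positivity)
  have e1 : 1 / t * (k * n / 2) = k / (2 * K) * √n := by
    rw [ht]; field_simp; nlinarith
  have e2 : 1 / t ^ 3 * (M * (1024 * M ^ 2 * n ^ 2)) = k / (8 * K) * √n := by
    have h3 : M ^ 3 = k * K ^ 2 / 8192 := by rw [K2]; field_simp
    have : M * (1024 * M ^ 2 * n ^ 2) = 1024 * M ^ 3 * (√n ^ 2) ^ 2 := by rw [sn2]; ring
    rw [this, h3, ht]; field_simp; norm_num
  have e3 : k / (4 * K) * √n = k / (2 * K) * √n - (k / (8 * K) * √n + k / (8 * K) * √n) := by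
    field_simp; ring
  linarith

lemma perm_inv (hp : 1 ≤ p) {n : ℕ} (s : Equiv.Perm (Fin n)) (g : (Fin n → ℝ) → ℝ) :
    ∫ x, g (fun i => x (s i)) ∂(PP p n) = ∫ x, g x ∂(PP p n) := by
  have := gam_prob hp
  have h := measurePreserving_piCongrLeft (α := fun _ : Fin n => ℝ) (fun _ => gam p) s
  have e := h.integral_comp (MeasurableEquiv.measurableEmbedding _)
    (fun x => g (fun i => x (s i)))
  rw [PP, ← e]
  congr 1; ext x; congr 1; ext i
  exact Equiv.piCongrLeft_apply_apply (fun _ => ℝ) s x i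

/-- invariance of `SS` -/
lemma SS_perm {n : ℕ} (s : Equiv.Perm (Fin n)) (x : Fin n → ℝ) :
    SS p (fun i => x (s i)) = SS p x := Equiv.sum_comp s (fun i => psi p (x i))

/-- weighted integral -/
def II (p : ℝ) (n : ℕ) (g : (Fin n → ℝ) → ℝ) : ℝ := ∫ x, g x * |SS p x| ∂(PP p n)

lemma II_perm (hp : 1 ≤ p) {n : ℕ} (s : Equiv.Perm (Fin n)) (g : (Fin n → ℝ) → ℝ) :
    II p n (fun x => g (fun i => x (s i))) = II p n g := by
  have := perm_inv hp s (fun x => g x * |SS p x|)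
  simp only [SS_perm] at this
  exact this

lemma exists_perm {n : ℕ} {i j k l : Fin n} (hij : i ≠ j) (hkl : k ≠ l) :
    ∃ s : Equiv.Perm (Fin n), s i = k ∧ s j = l := by
  refine ⟨Equiv.swap (Equiv.swap i k j) l * Equiv.swap i k, ?_, ?_⟩
  · simp only [Equiv.Perm.mul_apply, Equiv.swap_apply_left]
    apply Equiv.swap_apply_of_ne_of_ne _ hkl
    intro h
    have : Equiv.swap i k i = Equiv.swap i k j := by rw [Equiv.swap_apply_left]; exact h
    exact hij ((Equiv.swap i k).injective this)
  · simp

lemma II_QQ (hp : 1 ≤ p) {n : ℕ} (hn : 2 ≤ n) : ∃ τ : ℝ,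
    (∀ i j : Fin n, i ≠ j → τ = ∫ x, (x i - x j) ^ 2 / 2 * |SS p x| ∂(PP p n)) ∧
    ∀ a : Fin n → Fin n → ℝ, (∀ i, ∑ j, a i j = 0) → II p n (QQ a) = τ * ∑ i, a i i := by
  have := PP_prob hp n
  set i0 : Fin n := ⟨0, by omega⟩
  set i1 : Fin n := ⟨1, by omega⟩
  have h01 : i0 ≠ i1 := by simp [i0, i1]
  have gS := good_SS (n := n) hp
  have g : ∀ i j : Fin n, Good (PP p n) fun x => x i * x j * |SS p x| := fun i j =>
    ((good_x hp i).mul (good_x hp j)).mul gS.abs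
  set α := II p n (fun x => x i0 * x i0) with hα
  set b := II p n (fun x => x i0 * x i1) with hb
  have hd : ∀ i, II p n (fun x => x i * x i) = α := by
    intro i
    have := II_perm hp (Equiv.swap i0 i) (fun x => x i0 * x i0)
    rw [hα, ← this]; simp
  have ho : ∀ i j, i ≠ j → II p n (fun x => x i * x j) = b := by
    intro i j hij
    obtain ⟨s, rfl, rfl⟩ := exists_perm h01 hij
    exact II_perm hp s (fun x => x i0 * x i1)
  refine ⟨α - b, fun i j hij => ?_, fun a ha => ?_⟩
  · have e : ∀ x : Fin n → ℝ, (x i - x j) ^ 2 / 2 * |SS p x| = (1/2) * (x i * x i * |SS p x|)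
      + (1/2) * (x j * x j * |SS p x|) + (-1) * (x i * x j * |SS p x|) := by intro x; ring
    simp_rw [e]
    rw [integral_add (((g i i).const_mul _).add ((g j j).const_mul _)).int ((g i j).const_mul _).int,
      integral_add ((g i i).const_mul _).int ((g j j).const_mul _).int, integral_const_mul,
      integral_const_mul, integral_const_mul]
    have h1 := hd i
    have h2 := hd j
    have h3 := ho i j hij
    unfold II at h1 h2 h3
    rw [h1, h2, h3]; ring
  · have e : ∀ x : Fin n → ℝ, QQ a x * |SS p x| = ∑ i, ∑ j, a i j * (x i * x j * |SS p x|) := by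
      intro x
      simp only [QQ, Finset.sum_mul, mul_assoc]
    rw [II]
    simp_rw [e]
    rw [integral_finsetSum _ fun i _ => (Good.sum _ fun j _ => (g i j).const_mul _).int,
      Finset.mul_sum]
    refine Finset.sum_congr rfl fun i _ => ?_
    rw [integral_finsetSum _ fun j _ => ((g i j).const_mul _).int]
    simp_rw [integral_const_mul]
    have : ∀ j, a i j * ∫ x, x i * x j * |SS p x| ∂(PP p n) =
        a i j * b + if i = j then a i j * (α - b) else 0 := by
      intro j
      split_ifs with h
      · subst h
        have := hd i
        unfold II at this
        rw [this]; ring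
      · have := ho i j h
        unfold II at this
        rw [this]; ring
    simp_rw [this]
    rw [Finset.sum_add_distrib, ← Finset.sum_mul, ha i]
    simp; ring

theorem core (hp : 1 ≤ p) : ∃ C : ℝ, 0 < C ∧ ∀ n : ℕ, 2 ≤ n → ∃ τ : ℝ, 0 < τ ∧
    0 < II p n (fun _ => 1) ∧
    ∀ a : Fin n → Fin n → ℝ, (∀ i j, a i j = a j i) → (∀ i, ∑ j, a i j = 0) →
      II p n (QQ a) = τ * ∑ i, a i i ∧
      II p n (fun x => QQ a x ^ 2) * II p n (fun _ => 1) - II p n (QQ a) ^ 2 ≤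
        C * τ ^ 2 * ∑ i, ∑ j, a i j ^ 2 := by
  obtain ⟨M1, h1⟩ := exists_mom hp (good_id hp) (fun t => rfl)
  obtain ⟨M2, h2⟩ := exists_mom hp (good_psi hp) psi_neg
  set M := max M1 M2
  have hx := h1 M (le_max_left _ _)
  have hψ := h2 M (le_max_right _ _)
  obtain ⟨c, cpos, hc⟩ := tau_lower hp hψ hx
  have hM1 : 1 ≤ M := (hx 1 0).one
  refine ⟨256 * M ^ 3 / c ^ 2, by positivity, fun n hn => ?_⟩
  have := PP_prob hp n
  obtain ⟨τ, hτ, hQ⟩ := II_QQ hp hn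
  have h01 : (⟨0, by omega⟩ : Fin n) ≠ ⟨1, by omega⟩ := by simp
  have hn' : (2 : ℝ) ≤ n := by exact_mod_cast hn
  have sn : 0 < √(n : ℝ) := Real.sqrt_pos.mpr (by linarith)
  have sn2 : √(n : ℝ) ^ 2 = n := Real.sq_sqrt (by linarith)
  have hτc : c * √n ≤ τ := by rw [hτ _ _ h01]; exact hc n hn _ _ h01
  have τpos : 0 < τ := lt_of_lt_of_le (by positivity) hτc
  have gS := good_SS (n := n) hp
  have hI0 : 0 ≤ II p n (fun _ => 1) := integral_nonneg fun x => by positivity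
  have hI : 0 < II p n (fun _ => 1) := by
    refine lt_of_le_of_ne hI0 fun h => ?_
    have hz : (fun x => (1:ℝ) * |SS p x|) =ᵐ[PP p n] 0 :=
      (integral_eq_zero_iff_of_nonneg (fun x => by positivity)
        ((Good.const 1).mul gS.abs).int).mp h.symm
    have : τ = 0 := by
      rw [hτ _ _ h01]
      rw [integral_eq_zero_of_ae]
      filter_upwards [hz] with x hx
      simp only [one_mul, Pi.zero_apply] at hx
      simp [hx]
    exact τpos.ne' this
  refine ⟨τ, τpos, hI, fun a has ha => ⟨hQ a ha, ?_⟩⟩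
  set A := ∑ i, ∑ j, a i j ^ 2 with hA
  have A0 : 0 ≤ A := Finset.sum_nonneg fun i _ => Finset.sum_nonneg fun j _ => sq_nonneg _
  set m := m2 p * ∑ i, a i i with hm
  have gQ := good_QQ hp a
  have gQm : Good (PP p n) (fun x => QQ a x - m) := gQ.sub (Good.const m)
  set s := √(n * M) with hs
  have s2 : s ^ 2 = n * M := Real.sq_sqrt (by positivity)
  have s0 : 0 ≤ s := Real.sqrt_nonneg _
  have hSS : ∫ x, |SS p x| ^ 2 ∂(PP p n) ≤ s ^ 2 := by
    simp_rw [sq_abs]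
    rw [SS_sq hp, s2]
    have := (hψ n ⟨0, by omega⟩).e2'
    exact mul_le_mul_of_nonneg_left this (by positivity)
  have b1 : II p n (fun _ => 1) ≤ 1 * s := by
    exact cs' (Good.const 1) gS.abs zero_le_one s0 (by simp) hSS
  have b2 : II p n (fun x => (QQ a x - m) ^ 2) ≤ (256 * M ^ 2 * A) * s := by
    refine cs' (gQm.pow 2) gS.abs (by positivity) s0 ?_ hSS
    have := quad_four (PP_indep hp n measurable_id) (hx n) a has Finset.univ
    refine le_trans (le_of_eq ?_) this
    congr 1; ext x
    simp only [id, QQ, hm, m2]; ring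
  have b20 : 0 ≤ II p n (fun x => (QQ a x - m) ^ 2) := integral_nonneg fun x => by positivity
  have e : II p n (fun x => (QQ a x - m) ^ 2) = II p n (fun x => QQ a x ^ 2)
      - 2 * m * II p n (QQ a) + m ^ 2 * II p n (fun _ => 1) := by
    unfold II
    have : ∀ x, (QQ a x - m) ^ 2 * |SS p x| = QQ a x ^ 2 * |SS p x|
      - 2 * m * (QQ a x * |SS p x|) + m ^ 2 * (1 * |SS p x|) := by intro x; ring
    simp_rw [this]
    have g1 := (gQ.pow 2).mul gS.abs
    have g2 := gQ.mul gS.abs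
    have g3 := (Good.const (P := PP p n) 1).mul gS.abs
    rw [integral_add (g1.sub (g2.const_mul _)).int (g3.const_mul _).int,
      integral_sub g1.int (g2.const_mul _).int, integral_const_mul, integral_const_mul]
  have e2 : II p n (fun x => QQ a x ^ 2) * II p n (fun _ => 1) - II p n (QQ a) ^ 2 ≤
      II p n (fun _ => 1) * II p n (fun x => (QQ a x - m) ^ 2) := by
    rw [e]
    nlinarith [sq_nonneg (m * II p n (fun _ => 1) - II p n (QQ a))]
  calc _ ≤ _ := e2
    _ ≤ (1 * s) * ((256 * M ^ 2 * A) * s) := by gcongr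
    _ = 256 * M ^ 2 * A * s ^ 2 := by ring
    _ = 256 * M ^ 3 / c ^ 2 * (c * √n) ^ 2 * A := by rw [s2, mul_pow, sn2]; field_simp
    _ ≤ _ := by gcongr

end Core2


/-! ### One dimensional integration -/

section FTC

variable {p : ℝ}

/-- `ℓ_p` energy along the diagonal -/
def phi (p : ℝ) {n : ℕ} (y : Fin n → ℝ) (t : ℝ) : ℝ := ∑ i, |y i + t| ^ p

lemma phi_cont (hp : 1 ≤ p) {n : ℕ} (y : Fin n → ℝ) : Continuous (phi p y) := by
  unfold phi
  refine continuous_finsetSum _ fun i _ => ?_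
  exact (continuous_abs.comp (continuous_const.add continuous_id)).rpow_const
    (fun x => Or.inr (by linarith))

lemma psi_nonneg {t : ℝ} (ht : 0 ≤ t) : 0 ≤ psi p t := by
  unfold psi
  rcases ht.eq_or_lt with rfl | h
  · simp
  · rw [Real.sign_of_pos h]; positivity

lemma psi_mono (hp : 1 ≤ p) : Monotone (psi p) := by
  have h1 : ∀ s t : ℝ, 0 ≤ s → s ≤ t → psi p s ≤ psi p t := by
    intro s t hs hst
    rcases hs.eq_or_lt with rfl | hs
    · have : psi p 0 = 0 := by simp [psi]
      rw [this]; exact psi_nonneg hst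
    · unfold psi
      rw [Real.sign_of_pos hs, Real.sign_of_pos (hs.trans_le hst), abs_of_pos hs,
        abs_of_pos (hs.trans_le hst), one_mul, one_mul]
      exact rpow_le_rpow hs.le hst (by linarith)
  intro s t hst
  rcases le_total 0 s with hs | hs
  · exact h1 s t hs hst
  rcases le_total 0 t with ht | ht
  · have a := psi_nonneg (p := p) ht
    have b := psi_nonneg (p := p) (neg_nonneg.mpr hs)
    rw [psi_neg] at b; linarith
  · have := h1 (-t) (-s) (by linarith) (by linarith)
    rw [psi_neg, psi_neg] at this; linarith

lemma hasDerivAt_abs_rpow' {t : ℝ} (ht : t ≠ 0) :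
    HasDerivAt (fun t : ℝ => |t| ^ p) (p * psi p t) t := by
  have h := (hasDerivAt_abs ht).rpow_const (p := p) (Or.inl (abs_ne_zero.mpr ht))
  convert h using 1
  unfold psi
  rcases lt_or_gt_of_ne ht with h | h
  · rw [Real.sign_of_neg h, _root_.sign_neg h]; simp
  · rw [Real.sign_of_pos h, _root_.sign_pos h]; simp

lemma phi_deriv {n : ℕ} (y : Fin n → ℝ) {t : ℝ} (ht : t ∉ Set.range fun i => -y i) :
    HasDerivAt (phi p y) (p * SS p (fun i => y i + t)) t := by
  unfold phi SS
  rw [Finset.mul_sum]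
  refine HasDerivAt.fun_sum fun i _ => ?_
  have h0 : y i + t ≠ 0 := fun h => ht ⟨i, by simp only; linarith⟩
  have := (hasDerivAt_abs_rpow' (p := p) h0).comp t ((hasDerivAt_id t).const_add (y i))
  simp only [mul_one] at this
  exact this

lemma SS_mono (hp : 1 ≤ p) {n : ℕ} (y : Fin n → ℝ) : Monotone fun t => SS p (fun i => y i + t) := by
  intro s t hst
  exact Finset.sum_le_sum fun i _ => psi_mono hp (by linarith)

lemma SS_nonneg_of_min (hp : 1 ≤ p) {n : ℕ} (y : Fin n → ℝ) {t0 : ℝ}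
    (h0 : ∀ t, phi p y t0 ≤ phi p y t) {t : ℝ} (ht : t0 < t) : 0 ≤ SS p (fun i => y i + t) := by
  by_contra! hneg
  have hi : IntervalIntegrable (fun t => p * SS p (fun i => y i + t)) volume t0 t :=
    ((SS_mono hp y).intervalIntegrable).const_mul p
  have h := integral_eq_of_hasDerivAt_off_countable_of_le (phi p y) _ ht.le
    (Set.countable_range fun i => -y i) (phi_cont hp y).continuousOn
    (fun x hx => phi_deriv y hx.2) hi
  have h2 : ∫ x in t0..t, p * SS p (fun i => y i + x) ≤ ∫ x in t0..t, p * SS p (fun i => y i + t) := by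
    refine intervalIntegral.integral_mono_on ht.le hi (by simp) fun x hx => ?_
    exact mul_le_mul_of_nonneg_left (SS_mono hp y hx.2) (by linarith)
  rw [h, intervalIntegral.integral_const, smul_eq_mul] at h2
  have := h0 t
  have : (t - t0) * (p * SS p fun i => y i + t) < 0 :=
    mul_neg_of_pos_of_neg (by linarith) (mul_neg_of_pos_of_neg (by linarith) hneg)
  linarith

lemma phi_tendsto (hp : 1 ≤ p) {n : ℕ} (hn : 1 ≤ n) (y : Fin n → ℝ) :
    Filter.Tendsto (phi p y) (Filter.cocompact ℝ) Filter.atTop := by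
  set i0 : Fin n := ⟨0, hn⟩
  refine Filter.tendsto_atTop_mono (f := fun t => |y i0 + t| ^ p) (fun t => ?_) ?_
  · exact Finset.single_le_sum (f := fun i => |y i + t| ^ p) (fun i _ => by positivity)
      (Finset.mem_univ i0)
  · refine (tendsto_rpow_atTop (by linarith)).comp ?_
    exact tendsto_norm_cocompact_atTop.comp (Homeomorph.addLeft (y i0)).isClosedEmbedding.tendsto_cocompact

lemma half (hp : 1 ≤ p) {n : ℕ} (hn : 1 ≤ n) (y : Fin n → ℝ) {t0 : ℝ}
    (h0 : ∀ t, phi p y t0 ≤ phi p y t) :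
    ∫⁻ t in Set.Ioi t0, ENNReal.ofReal (p * |SS p (fun i => y i + t)| * exp (-phi p y t)) =
      ENNReal.ofReal (exp (-phi p y t0)) := by
  have hc := phi_cont hp y
  refine AECover.lintegral_eq_of_tendsto (l := Filter.atTop) (μ := volume.restrict (Set.Ioi t0))
    (φ := fun b : ℝ => Set.Iic b) (aecover_Iic Filter.tendsto_id) _ ?_ ?_
  · have : Measurable fun t => SS p (fun i => y i + t) := (SS_mono hp y).measurable
    have := hc.measurable
    fun_prop
  have hev : ∀ᶠ b in Filter.atTop, ENNReal.ofReal (exp (-phi p y t0) - exp (-phi p y b)) =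
      ∫⁻ t in Set.Iic b, ENNReal.ofReal (p * |SS p (fun i => y i + t)| * exp (-phi p y t))
        ∂(volume.restrict (Set.Ioi t0)) := by
    filter_upwards [Filter.eventually_ge_atTop t0] with b hb
    rw [Measure.restrict_restrict measurableSet_Iic, Set.inter_comm, Set.Ioi_inter_Iic]
    have hi : IntervalIntegrable (fun t => p * SS p (fun i => y i + t) * exp (-phi p y t))
        volume t0 b :=
      (((SS_mono hp y).intervalIntegrable).const_mul p).mul_continuousOn
        (hc.neg.rexp).continuousOn
    have h := integral_eq_of_hasDerivAt_off_countable_of_le (fun t => -exp (-phi p y t))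
      (fun t => p * SS p (fun i => y i + t) * exp (-phi p y t)) hb
      (Set.countable_range fun i => -y i) (hc.neg.rexp.neg).continuousOn
      (fun x hx => by
        have := ((phi_deriv (p := p) y hx.2).neg.exp).neg
        have e : (-(rexp ((-phi p y) x) * -(p * SS p fun i => y i + x))) =
          (p * SS p fun i => y i + x) * rexp (-phi p y x) := by
          simp only [Pi.neg_apply]; ring
        rw [e] at this
        exact this) hi
    rw [show exp (-phi p y t0) - exp (-phi p y b) = -exp (-phi p y b) - -exp (-phi p y t0) by ring,
      ← h, intervalIntegral.integral_of_le hb, ofReal_integral_eq_lintegral_ofReal]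
    · refine setLIntegral_congr_fun measurableSet_Ioc fun t ht => ?_
      simp only [abs_of_nonneg (SS_nonneg_of_min hp y h0 ht.1)]
    · exact hi.1
    · filter_upwards [ae_restrict_mem measurableSet_Ioc] with t ht
      have := SS_nonneg_of_min hp y h0 ht.1
      simp only [Pi.zero_apply]
      positivity
  refine Filter.Tendsto.congr' hev ?_
  refine ENNReal.tendsto_ofReal ?_
  have : Filter.Tendsto (phi p y) Filter.atTop Filter.atTop :=
    (phi_tendsto hp hn y).mono_left atTop_le_cocompact
  have h2 := (Real.tendsto_exp_neg_atTop_nhds_zero.comp this)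
  simpa using h2.const_sub (exp (-phi p y t0))

lemma full (hp : 1 ≤ p) {n : ℕ} (hn : 1 ≤ n) (y : Fin n → ℝ) :
    ∫⁻ t, ENNReal.ofReal (|SS p (fun i => y i + t)| * ∏ i, wt p (y i + t)) =
      ENNReal.ofReal (2 / p) * ∫⁻ s in Set.Ioi 0,
        {s : ℝ | ∃ t, phi p y t ≤ s}.indicator (fun s => ENNReal.ofReal (exp (-s))) s := by
  have hp0 : 0 < p := by linarith
  obtain ⟨t0, h0⟩ := (phi_cont hp y).exists_forall_le (phi_tendsto hp hn y)
  have hneg : ∀ t, phi p (fun i => -y i) t = phi p y (-t) := by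
    intro t; unfold phi; congr 1; ext i; rw [← abs_neg]; congr 2; ring
  have hSneg : ∀ t, |SS p (fun i => -y i + t)| = |SS p (fun i => y i + -t)| := by
    intro t; unfold SS; rw [← abs_neg, ← Finset.sum_neg_distrib]; congr 2; ext i
    rw [← psi_neg]; congr 1; ring
  have hr := half hp hn y h0
  have hl := half hp hn (fun i => -y i) (t0 := -t0)
    (fun t => by rw [hneg, hneg, neg_neg]; exact h0 _)
  simp only [hneg, hSneg, neg_neg] at hl
  set G : ℝ → ℝ≥0∞ := fun t =>
    ENNReal.ofReal (p * |SS p (fun i => y i + t)| * exp (-phi p y t)) with hG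
  have hl2 : ∫⁻ t in Set.Iio t0, G t = ENNReal.ofReal (exp (-phi p y t0)) := by
    rw [← hl]
    have := (Measure.measurePreserving_neg (volume : Measure ℝ)).setLIntegral_comp_preimage_emb
      (MeasurableEquiv.neg ℝ).measurableEmbedding G (Set.Iio t0)
    rw [← this]
    simp [hG]
  have hfull : ∫⁻ t, G t = ENNReal.ofReal (2 * exp (-phi p y t0)) := by
    rw [← lintegral_add_compl G (measurableSet_Ioi (a := t0)), Set.compl_Ioi, hr,
      setLIntegral_congr (Iio_ae_eq_Iic (a := t0)).symm, hl2, ← ENNReal.ofReal_add (by positivity) (by positivity)]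
    congr 1; ring
  have e1 : ∀ t, ENNReal.ofReal (|SS p (fun i => y i + t)| * ∏ i, wt p (y i + t)) =
      ENNReal.ofReal (1 / p) * G t := by
    intro t
    rw [hG, ← ENNReal.ofReal_mul (by positivity)]
    congr 1
    simp only [wt, phi]
    rw [← Real.exp_sum, Finset.sum_neg_distrib]
    field_simp
  have hφ0 : 0 ≤ phi p y t0 := Finset.sum_nonneg fun i _ => by positivity
  have e2 : ∫⁻ s in Set.Ioi 0, {s : ℝ | ∃ t, phi p y t ≤ s}.indicator 
      (fun s => ENNReal.ofReal (exp (-s))) s = ENNReal.ofReal (exp (-phi p y t0)) := by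
    have : {s : ℝ | ∃ t, phi p y t ≤ s} = Set.Ici (phi p y t0) := by
      ext s; exact ⟨fun ⟨t, ht⟩ => (h0 t).trans ht, fun h => ⟨t0, h⟩⟩
    rw [this, lintegral_indicator measurableSet_Ici, Measure.restrict_restrict measurableSet_Ici,
      ← integral_exp_neg_Ioi, ofReal_integral_eq_lintegral_ofReal (integrableOn_exp_neg_Ioi _)
        (ae_of_all _ fun t => (exp_pos _).le)]
    apply setLIntegral_congr
    refine Filter.EventuallyEq.trans ?_ (Filter.EventuallyEq.refl _ _)
    have h1 : (Set.Ici (phi p y t0) ∩ Set.Ioi 0 : Set ℝ) =ᵐ[volume] 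
        (Set.Ioi (phi p y t0) ∩ Set.Ioi 0 : Set ℝ) :=
      (Ioi_ae_eq_Ici (a := phi p y t0)).symm.inter (Filter.EventuallyEq.refl _ _)
    rwa [Set.inter_eq_left.mpr (Set.Ioi_subset_Ioi hφ0)] at h1
  simp_rw [e1]
  rw [lintegral_const_mul' _ _ (by simp), hfull, e2, ← ENNReal.ofReal_mul (by positivity),
    ← ENNReal.ofReal_mul (by positivity)]
  congr 1; ring

end FTC


/-! ### The hyperplane -/

section Geo

variable {p : ℝ} {n : ℕ}

/-- the hyperplane -/
def HH (n : ℕ) : Submodule ℝ (E n) := (Submodule.span ℝ {theta0 n})ᗮ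

lemma mem_HH {y : E n} : y ∈ HH n ↔ ⟪y, theta0 n⟫ = 0 := by
  rw [HH, Submodule.mem_orthogonal_singleton_iff_inner_left]

lemma inner_theta (y : E n) : ⟪y, theta0 n⟫ = (∑ i, y i) * (√n)⁻¹ := by
  rw [PiLp.inner_apply, Finset.sum_mul]
  refine Finset.sum_congr rfl fun i _ => ?_
  simp [theta0, mul_comm]

lemma mem_HH' (hn : 1 ≤ n) {y : E n} : y ∈ HH n ↔ ∑ i, y i = 0 := by
  rw [mem_HH, inner_theta]
  have : (√(n:ℝ))⁻¹ ≠ 0 := by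
    have : 0 < (n : ℝ) := by exact_mod_cast hn
    positivity
  simp [this]

lemma finrank_HH (hn : 1 ≤ n) : Module.finrank ℝ (HH n) + 1 = n := by
  have h := Submodule.finrank_add_finrank_orthogonal (Submodule.span ℝ {theta0 n})
  have h0 : theta0 n ≠ 0 := by
    intro h
    have := congrArg (fun v : E n => v ⟨0, hn⟩) h
    have hn' : 0 < (n : ℝ) := by exact_mod_cast hn
    simp [theta0] at this
    omega
  rw [finrank_span_singleton h0] at h
  simp at h
  unfold HH
  omega

/-- coordinates -/
def Llin (n : ℕ) : (HH n × ℝ) →ₗ[ℝ] (Fin n → ℝ) where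
  toFun z i := (z.1 : E n) i + z.2
  map_add' a b := by ext i; simp; ring
  map_smul' c a := by ext i; simp; ring

lemma Llin_bij (hn : 1 ≤ n) : Function.Bijective (Llin n) := by
  have hn' : (n : ℝ) ≠ 0 := by
    have : 0 < (n : ℝ) := by exact_mod_cast hn
    exact this.ne'
  constructor
  · rw [injective_iff_map_eq_zero]
    rintro ⟨y, t⟩ h
    have h1 : ∀ i, (y : E n) i + t = 0 := fun i => congrFun h i
    have h2 : ∑ i, (y : E n) i = 0 := (mem_HH' hn).mp y.2
    have h3 : ∑ i : Fin n, ((y : E n) i + t) = 0 := Finset.sum_eq_zero fun i _ => h1 i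
    rw [Finset.sum_add_distrib, h2] at h3
    simp [hn'] at h3
    have h4 : y = 0 := by
      ext i
      have := h1 i
      rw [h3] at this
      simpa using this
    rw [h4, h3]; rfl
  · intro x
    refine ⟨⟨⟨WithLp.toLp 2 (fun i => x i - (∑ j, x j) / n), ?_⟩, (∑ j, x j) / n⟩, ?_⟩
    · rw [mem_HH' hn]
      simp [Finset.sum_sub_distrib]
      field_simp; ring
    · ext i; simp [Llin]

/-- coordinates, as a continuous linear equivalence -/
def LL (hn : 1 ≤ n) : (HH n × ℝ) ≃L[ℝ] (Fin n → ℝ) :=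
  (LinearEquiv.ofBijective (Llin n) (Llin_bij hn)).toContinuousLinearEquiv

lemma LL_apply (hn : 1 ≤ n) (y : HH n) (t : ℝ) : LL hn (y, t) = fun i => (y : E n) i + t := rfl

/-- the projection in coordinates -/
def pr (hn : 1 ≤ n) : (Fin n → ℝ) →L[ℝ] HH n :=
  (ContinuousLinearMap.fst ℝ (HH n) ℝ).comp (LL hn).symm.toContinuousLinearMap

lemma pr_LL (hn : 1 ≤ n) (y : HH n) (t : ℝ) : pr hn (LL hn (y, t)) = y := by
  simp [pr]

lemma pr_eq (hn : 1 ≤ n) (x : E n) : (pr hn (fun i => x i) : E n) = projPerp (theta0 n) x := by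
  have hn' : 0 < (n : ℝ) := by exact_mod_cast hn
  have hm : projPerp (theta0 n) x ∈ HH n := by
    rw [mem_HH' hn]
    unfold projPerp
    rw [inner_theta]
    simp [theta0, Finset.sum_sub_distrib]
    have hq : √(n:ℝ) * √n = n := Real.mul_self_sqrt hn'.le
    have : √(n:ℝ) ≠ 0 := by positivity
    field_simp
    rw [sq, hq]; ring
  have : (fun i => x i) = LL hn (⟨_, hm⟩, ⟪x, theta0 n⟫ * (√n)⁻¹) := by
    rw [LL_apply]; ext i; simp [projPerp, theta0]
  rw [this, pr_LL]

/-- the body, in the hyperplane -/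
def KK (p : ℝ) (n : ℕ) : Set (HH n) := {y | ∃ t, phi p (fun i => (y : E n) i) t ≤ 1}

/-- the ball in coordinates -/
def BB (p : ℝ) (n : ℕ) : Set (Fin n → ℝ) := {x | ∑ i, |x i| ^ p ≤ 1}

lemma BB_compact (hp : 1 ≤ p) : IsCompact (BB p n) := by
  have hc : Continuous fun x : Fin n → ℝ => ∑ i, |x i| ^ p :=
    continuous_finsetSum _ fun i _ => (continuous_abs.comp (continuous_apply i)).rpow_const
      (fun x => Or.inr (by linarith))
  refine IsCompact.of_isClosed_subset (isCompact_univ_pi fun _ : Fin n => isCompact_Icc (a := (-1:ℝ)) (b := 1))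
    (isClosed_le hc continuous_const) ?_
  intro x hx i _
  have h1 : |x i| ^ p ≤ 1 := le_trans (Finset.single_le_sum (f := fun i => |x i| ^ p)
    (fun i _ => by positivity) (Finset.mem_univ i)) hx
  have : |x i| ≤ 1 := by
    by_contra! h
    exact absurd h1 (not_le.mpr (one_lt_rpow h (by linarith)))
  exact abs_le.mp this

lemma KK_eq (hn : 1 ≤ n) : KK p n = pr hn '' BB p n := by
  ext y
  constructor
  · rintro ⟨t, ht⟩
    exact ⟨LL hn (y, t), ht, pr_LL hn y t⟩
  · rintro ⟨x, hx, rfl⟩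
    refine ⟨((LL hn).symm x).2, ?_⟩
    have : LL hn (pr hn x, ((LL hn).symm x).2) = x := by simp [pr]
    have h2 : phi p (fun i => (pr hn x : E n) i) ((LL hn).symm x).2
      = ∑ i, |LL hn (pr hn x, ((LL hn).symm x).2) i| ^ p := rfl
    rw [h2, this]; exact hx

lemma KK_compact (hp : 1 ≤ p) (hn : 1 ≤ n) : IsCompact (KK p n) := by
  rw [KK_eq hn]; exact (BB_compact hp).image (pr hn).continuous

lemma KK_image (hn : 1 ≤ n) : projPerp (theta0 n) '' lpBall n p = Subtype.val '' KK p n := by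
  rw [KK_eq hn, Set.image_image]
  ext y
  constructor
  · rintro ⟨x, hx, rfl⟩
    exact ⟨fun i => x i, hx, pr_eq hn x⟩
  · rintro ⟨x, hx, rfl⟩
    exact ⟨WithLp.toLp 2 x, hx, (pr_eq hn (WithLp.toLp 2 x)).symm⟩

/-- scaling -/
lemma KK_scale (hp : 1 ≤ p) {s : ℝ} (hs : 0 < s) (y : HH n) :
    (∃ t, phi p (fun i => (y : E n) i) t ≤ s) ↔ (s ^ (-(1 / p))) • y ∈ KK p n := by
  have hr : 0 < s ^ (-(1 / p)) := by positivity
  have hrp : (s ^ (-(1 / p))) ^ p = s⁻¹ := by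
    rw [← rpow_mul hs.le, show -(1/p) * p = -1 by field_simp, rpow_neg_one]
  set r := s ^ (-(1 / p))
  have key : ∀ t, phi p (fun i => ((r • y : HH n) : E n) i) (r * t) =
      s⁻¹ * phi p (fun i => (y : E n) i) t := by
    intro t
    unfold phi
    rw [Finset.mul_sum]
    refine Finset.sum_congr rfl fun i _ => ?_
    have : ((r • y : HH n) : E n) i + r * t = r * ((y : E n) i + t) := by simp; ring
    rw [this, abs_mul, mul_rpow (abs_nonneg _) (abs_nonneg _), abs_of_pos hr, hrp]
  constructor
  · rintro ⟨t, ht⟩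
    refine ⟨r * t, ?_⟩
    rw [key, inv_mul_le_iff₀ hs]; linarith
  · rintro ⟨t, ht⟩
    refine ⟨r⁻¹ * t, ?_⟩
    have := key (r⁻¹ * t)
    rw [← mul_assoc, mul_inv_cancel₀ hr.ne', one_mul] at this
    rw [this, inv_mul_le_iff₀ hs] at ht
    linarith

end Geo


section Polar

variable {p : ℝ} {n : ℕ}

lemma KK_scale' (hp : 1 ≤ p) {s : ℝ} (hs : 0 < s) (y : HH n) :
    s ∈ {s : ℝ | ∃ t, phi p (fun i => (y : E n) i) t ≤ s} ↔ (s ^ (-(1 / p))) • y ∈ KK p n :=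
  KK_scale hp hs y

lemma gamma_lint (hp : 1 ≤ p) {q : ℝ} (hq : 0 ≤ q) :
    ∫⁻ s in Set.Ioi 0, ENNReal.ofReal (exp (-s)) * ENNReal.ofReal (s ^ q) =
      ENNReal.ofReal (Gamma (q + 1)) := by
  rw [Real.Gamma_eq_integral (by linarith), ofReal_integral_eq_lintegral_ofReal
    (Real.GammaIntegral_convergent (by linarith))]
  · refine setLIntegral_congr_fun measurableSet_Ioi fun s hs => ?_
    rw [← ENNReal.ofReal_mul (exp_pos _).le]
    simp
  · filter_upwards [ae_restrict_mem measurableSet_Ioi] with s hs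
    have : (0:ℝ) < s := hs
    simp only [Pi.zero_apply]
    positivity

/-- homogeneous integrals over the scaled body -/
lemma scale_lint (hp : 1 ≤ p) (hn : 1 ≤ n) (η : Measure (HH n)) [η.IsAddHaarMeasure]
    {d : ℕ} {g : HH n → ℝ≥0∞} (hg : Measurable g)
    (hom : ∀ r : ℝ, 0 < r → ∀ y, g (r • y) = ENNReal.ofReal (r ^ d) * g y) {s : ℝ} (hs : 0 < s) :
    ∫⁻ y, g y * {s : ℝ | ∃ t, phi p (fun i => (y : E n) i) t ≤ s}.indicator 1 s ∂η =
      ENNReal.ofReal (s ^ ((n - 1 + d : ℝ) / p)) * ∫⁻ y in KK p n, g y ∂η := by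
  have hK := (KK_compact (n := n) hp hn).measurableSet
  have hp0 : 0 < p := by linarith
  set r := s ^ (-(1 / p)) with hr
  have rpos : 0 < r := by positivity
  have e1 : ∀ y : HH n, g y * {s : ℝ | ∃ t, phi p (fun i => (y : E n) i) t ≤ s}.indicator 1 s
      = ENNReal.ofReal (r⁻¹ ^ d) * (KK p n).indicator g (r • y) := by
    intro y
    have hy : g y = ENNReal.ofReal (r⁻¹ ^ d) * g (r • y) := by
      rw [← hom _ (by positivity), smul_smul, inv_mul_cancel₀ rpos.ne', one_smul]
    by_cases h : r • y ∈ KK p n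
    · rw [Set.indicator_of_mem h, Set.indicator_of_mem ((KK_scale' hp hs y).mpr h), ← hy]
      simp
    · rw [Set.indicator_of_notMem h, Set.indicator_of_notMem (fun h' => h ((KK_scale' hp hs y).mp h'))]
      simp
  simp_rw [e1]
  rw [lintegral_const_mul' _ _ (by simp)]
  have hm : Measurable ((KK p n).indicator g) := hg.indicator hK
  rw [← lintegral_map (f := (KK p n).indicator g) (g := fun y : HH n => r • y) hm
    (measurable_const_smul r), Measure.map_addHaar_smul η rpos.ne', lintegral_smul_measure,
    lintegral_indicator hK, smul_eq_mul, ← mul_assoc, ← ENNReal.ofReal_mul (by positivity)]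
  congr 2
  have hf : (Module.finrank ℝ (HH n) : ℝ) = n - 1 := by
    have := finrank_HH hn
    have : (Module.finrank ℝ (HH n) : ℝ) + 1 = n := by exact_mod_cast this
    linarith
  rw [abs_of_pos (by positivity), ← inv_pow, ← pow_add, hr, ← rpow_neg hs.le, ← rpow_natCast,
    ← rpow_mul hs.le]
  congr 1
  push_cast
  rw [hf]; field_simp; ring

theorem polar (hp : 1 ≤ p) (hn : 1 ≤ n) (η : Measure (HH n)) [η.IsAddHaarMeasure] :
    ∃ κ : ℝ≥0∞, κ ≠ 0 ∧ κ ≠ ∞ ∧ ∀ (d : ℕ) (g : HH n → ℝ≥0∞), Measurable g →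
    (∀ r : ℝ, 0 < r → ∀ y, g (r • y) = ENNReal.ofReal (r ^ d) * g y) →
    ENNReal.ofReal (Gamma ((n - 1 + d : ℝ) / p + 1)) * ∫⁻ y in KK p n, g y ∂η =
      κ * ∫⁻ x, g (pr hn x) * ENNReal.ofReal |SS p x| ∂(PP p n) := by
  have hp0 : 0 < p := by linarith
  have hK := (KK_compact (n := n) hp hn).measurableSet
  have hhaar : (Measure.map (LL hn) (η.prod volume)).IsAddHaarMeasure :=
    ContinuousLinearEquiv.isAddHaarMeasure_map _ _
  have hc := Measure.isAddLeftInvariant_eq_smul (Measure.map (LL hn) (η.prod volume))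
    (volume : Measure (Fin n → ℝ))
  set c := Measure.addHaarScalarFactor (Measure.map (LL hn) (η.prod volume)) 
    (volume : Measure (Fin n → ℝ))
  have cpos : 0 < c := Measure.addHaarScalarFactor_pos_of_isAddHaarMeasure _ _
  set b := ENNReal.ofReal (2 / p) with hb
  have b0 : b ≠ 0 := by simp [hb]; positivity
  have bt : b ≠ ∞ := by simp [hb]
  refine ⟨b⁻¹ * ((c : ℝ≥0∞) * ZZ p ^ n), ?_, ?_, fun d g hg hom => ?_⟩
  · refine mul_ne_zero (by simpa using bt) (mul_ne_zero ?_ (pow_ne_zero _ (ZZ_ne_zero hp)))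
    simpa using cpos.ne'
  · exact ENNReal.mul_ne_top (by simpa using b0)
      (ENNReal.mul_ne_top (by simp) (ENNReal.pow_ne_top (ZZ_ne_top hp)))
  set F : (Fin n → ℝ) → ℝ≥0∞ := fun x => g (pr hn x) * ENNReal.ofReal |SS p x| *
    ENNReal.ofReal (∏ i, wt p (x i)) with hF
  have hwm : Measurable fun x : Fin n → ℝ => ENNReal.ofReal (∏ i, wt p (x i)) :=
    (Finset.measurable_prod _ fun i _ =>
      (wt_cont hp).measurable.comp (measurable_pi_apply i)).ennreal_ofReal
  have hgm : Measurable fun x : Fin n → ℝ => g (pr hn x) * ENNReal.ofReal |SS p x| :=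
    (hg.comp (pr hn).continuous.measurable).mul ((measurable_abs.comp SS_meas).ennreal_ofReal)
  have hFm : Measurable F := hgm.mul hwm
  -- right hand side
  have r1 : ∫⁻ x, F x = ZZ p ^ n * ∫⁻ x, g (pr hn x) * ENNReal.ofReal |SS p x| ∂(PP p n) := by
    rw [← smul_eq_mul (ZZ p ^ n), ← lintegral_smul_measure, ← PP_eq hp n,
      lintegral_withDensity_eq_lintegral_mul _ hwm hgm]
    congr 1; ext x; simp only [hF, Pi.mul_apply]; ring
  have r2 : ∫⁻ z, F (LL hn z) ∂(η.prod volume) = c * ∫⁻ x, F x := by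
    rw [← lintegral_map hFm (LL hn).continuous.measurable, hc]
    rw [lintegral_smul_measure]; rfl
  -- left hand side
  have l1 : ∫⁻ z, F (LL hn z) ∂(η.prod volume) = ∫⁻ y, g y * (b * ∫⁻ s in Set.Ioi 0,
        {s : ℝ | ∃ t, phi p (fun i => (y : E n) i) t ≤ s}.indicator
          (fun s => ENNReal.ofReal (exp (-s))) s) ∂η := by
    rw [lintegral_prod (fun z => F (LL hn z)) (hFm.comp (LL hn).continuous.measurable).aemeasurable]
    congr 1; ext y
    rw [← full hp hn, ← lintegral_const_mul]
    · congr 1; ext t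
      simp only [hF, pr_LL]
      simp only [LL_apply]
      rw [mul_assoc, ← ENNReal.ofReal_mul (abs_nonneg _)]
    · have h1 : Measurable fun t => SS p (fun i => (y : E n) i + t) := (SS_mono hp _).measurable
      have h2 : Measurable fun t => ∏ i, wt p ((y : E n) i + t) :=
        Finset.measurable_prod _ fun i _ => (wt_cont hp).measurable.comp (measurable_const_add _)
      exact ((measurable_abs.comp h1).mul h2).ennreal_ofReal
  have hmeas : Measurable fun z : HH n × ℝ => g z.1 * 
      ((Set.Ioi (0:ℝ)).indicator (fun _ => (1 : ℝ≥0∞)) z.2 * 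
      (KK p n).indicator (fun _ => (1 : ℝ≥0∞)) (z.2 ^ (-(1/p)) • z.1)) * ENNReal.ofReal (exp (-z.2)) := by
    refine ((hg.comp measurable_fst).mul (Measurable.mul ?_ ?_)).mul ?_
    · exact (measurable_const.indicator measurableSet_Ioi).comp measurable_snd
    · refine (measurable_const.indicator hK).comp ?_
      exact (measurable_snd.pow_const _).smul measurable_fst
    · exact (measurable_snd.neg.exp).ennreal_ofReal
  have hind : ∀ (y : HH n), ∀ s ∈ Set.Ioi (0:ℝ), 
      {s : ℝ | ∃ t, phi p (fun i => (y : E n) i) t ≤ s}.indicator (1 : ℝ → ℝ≥0∞) s =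
      (Set.Ioi (0:ℝ)).indicator (fun _ => (1 : ℝ≥0∞)) s * 
      (KK p n).indicator (fun _ => (1 : ℝ≥0∞)) (s ^ (-(1/p)) • y) := by
    intro y s hs
    rw [Set.indicator_of_mem hs, one_mul]
    by_cases h : s ^ (-(1/p)) • y ∈ KK p n
    · rw [Set.indicator_of_mem h, Set.indicator_of_mem ((KK_scale' hp hs y).mpr h)]; rfl
    · rw [Set.indicator_of_notMem h, Set.indicator_of_notMem (fun h' => h ((KK_scale' hp hs y).mp h'))]
  have l2 : ∫⁻ y, g y * (b * ∫⁻ s in Set.Ioi 0,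
        {s : ℝ | ∃ t, phi p (fun i => (y : E n) i) t ≤ s}.indicator
          (fun s => ENNReal.ofReal (exp (-s))) s) ∂η =
      b * (ENNReal.ofReal (Gamma ((n - 1 + d : ℝ) / p + 1)) * ∫⁻ y in KK p n, g y ∂η) := by
    have a1 : ∀ y : HH n, g y * (b * ∫⁻ s in Set.Ioi 0,
        {s : ℝ | ∃ t, phi p (fun i => (y : E n) i) t ≤ s}.indicator
          (fun s => ENNReal.ofReal (exp (-s))) s) = 
        b * ∫⁻ s in Set.Ioi 0, g y * ((Set.Ioi (0:ℝ)).indicator (fun _ => (1 : ℝ≥0∞)) s * 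
      (KK p n).indicator (fun _ => (1 : ℝ≥0∞)) (s ^ (-(1/p)) • y)) * ENNReal.ofReal (exp (-s)) := by
      intro y
      rw [← mul_assoc, mul_comm (g y), mul_assoc]
      congr 1
      rw [← lintegral_const_mul'']
      · refine setLIntegral_congr_fun measurableSet_Ioi fun s hs => ?_
        simp only
        rw [← hind y s hs, mul_assoc]
        congr 1
        by_cases h : s ∈ {s : ℝ | ∃ t, phi p (fun i => (y : E n) i) t ≤ s}
        · rw [Set.indicator_of_mem h, Set.indicator_of_mem h]; simp
        · rw [Set.indicator_of_notMem h, Set.indicator_of_notMem h]; simp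
      · have : Measurable fun s : ℝ => ((Set.Ioi (0:ℝ)).indicator (fun _ => (1 : ℝ≥0∞)) s * 
            (KK p n).indicator (fun _ => (1 : ℝ≥0∞)) (s ^ (-(1/p)) • y)) * ENNReal.ofReal (exp (-s)) := by
          refine (Measurable.mul ?_ ?_).mul ?_
          · exact (measurable_const.indicator measurableSet_Ioi)
          · refine (measurable_const.indicator hK).comp ?_
            exact (measurable_id.pow_const _).smul measurable_const
          · exact (measurable_id.neg.exp).ennreal_ofReal
        refine this.aemeasurable.congr ?_
        filter_upwards [ae_restrict_mem measurableSet_Ioi] with s hs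
        rw [← hind y s hs]
        by_cases h : s ∈ {s : ℝ | ∃ t, phi p (fun i => (y : E n) i) t ≤ s}
        · rw [Set.indicator_of_mem h, Set.indicator_of_mem h]; simp
        · rw [Set.indicator_of_notMem h, Set.indicator_of_notMem h]; simp
    simp_rw [a1]
    rw [lintegral_const_mul' _ _ bt]
    congr 1
    rw [lintegral_lintegral_swap hmeas.aemeasurable, ← gamma_lint hp (q := (n - 1 + d : ℝ) / p),
      ← lintegral_mul_const'']
    · refine setLIntegral_congr_fun measurableSet_Ioi fun s hs => ?_
      rw [lintegral_mul_const' _ _ (by simp), mul_comm, mul_assoc]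
      congr 1
      rw [← scale_lint hp hn η hg hom hs]
      congr 1; ext y
      rw [hind y s hs]
    · exact ((measurable_id.neg.exp).ennreal_ofReal.mul
        (measurable_id.pow_const _).ennreal_ofReal).aemeasurable
    · have : (1 : ℝ) ≤ n := by exact_mod_cast hn
      have : (0 : ℝ) ≤ n - 1 := by linarith
      positivity
  rw [mul_assoc, mul_assoc, ← r1, ← r2, l1, l2, ← mul_assoc, ENNReal.inv_mul_cancel b0 bt, one_mul]

end Polar

section Fin
variable {p : ℝ} {n : ℕ}

lemma polar_real (hp : 1 ≤ p) (hn : 1 ≤ n) (η : Measure (HH n)) [η.IsAddHaarMeasure] :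
    ∃ κ : ℝ, 0 < κ ∧ ∀ (d : ℕ) (G : HH n → ℝ), Continuous G → (∀ y, 0 ≤ G y) →
      (∀ r, 0 < r → ∀ y, G (r • y) = r ^ d * G y) → Good (PP p n) (fun x => G (pr hn x)) →
      Gamma ((n - 1 + d : ℝ) / p + 1) * ∫ y in KK p n, G y ∂η =
        κ * II p n (fun x => G (pr hn x)) := by
  haveI := PP_prob hp n
  obtain ⟨κ, k0, kt, h⟩ := polar hp hn η
  refine ⟨κ.toReal, ENNReal.toReal_pos k0 kt, fun d G hc h0 hom hg => ?_⟩
  have hk := h d (fun y => ENNReal.ofReal (G y)) hc.measurable.ennreal_ofReal (fun r hr y => by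
    rw [hom r hr y, ENNReal.ofReal_mul (by positivity)])
  have hG : (0:ℝ) ≤ Gamma ((n - 1 + d : ℝ) / p + 1) := by
    apply (Gamma_pos_of_pos _).le
    have : (1 : ℝ) ≤ n := by exact_mod_cast hn
    have : (0 : ℝ) ≤ n - 1 := by linarith
    positivity
  rw [← ofReal_integral_eq_lintegral_ofReal
    (hc.continuousOn.integrableOn_compact (KK_compact hp hn)) (Filter.Eventually.of_forall h0)] at hk
  simp_rw [← ENNReal.ofReal_mul (h0 _)] at hk
  rw [← ofReal_integral_eq_lintegral_ofReal (hg.mul (good_SS hp).abs).int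
    (Filter.Eventually.of_forall fun x => mul_nonneg (h0 _) (abs_nonneg _))] at hk
  have := congrArg ENNReal.toReal hk
  rw [ENNReal.toReal_mul, ENNReal.toReal_mul, ENNReal.toReal_ofReal hG, ENNReal.toReal_ofReal,
    ENNReal.toReal_ofReal] at this
  · exact this
  · exact integral_nonneg fun x => mul_nonneg (h0 _) (abs_nonneg _)
  · exact integral_nonneg fun x => h0 _

lemma gamma_log {q a : ℝ} (hq : 0 ≤ q) (ha : 0 ≤ a) :
    Gamma (q + a + 1) ^ 2 ≤ Gamma (q + 1) * Gamma (q + 2 * a + 1) := by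
  have h := Gamma_mul_add_mul_le_rpow_Gamma_mul_rpow_Gamma (s := q + 1) (t := q + 2 * a + 1)
    (a := 1/2) (b := 1/2) (by positivity) (by positivity) (by norm_num) (by norm_num) (by norm_num)
  have e : 1 / 2 * (q + 1) + 1 / 2 * (q + 2 * a + 1) = q + a + 1 := by ring
  rw [e, ← Real.sqrt_eq_rpow, ← Real.sqrt_eq_rpow] at h
  have p1 := Gamma_pos_of_pos (show 0 < q + 1 by positivity)
  have p2 := Gamma_pos_of_pos (show 0 < q + 2 * a + 1 by positivity)
  have p3 := Gamma_pos_of_pos (show 0 < q + a + 1 by positivity)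
  calc _ ≤ (√(Gamma (q + 1)) * √(Gamma (q + 2 * a + 1))) ^ 2 := by gcongr
    _ = _ := by rw [mul_pow, Real.sq_sqrt p1.le, Real.sq_sqrt p2.le]

/-- the vectors `A (P e_i)` -/
def vv (hn : 1 ≤ n) (A : HH n →L[ℝ] HH n) (i : Fin n) : E n := (A (pr hn (Pi.single i 1)) : E n)

lemma A_pr (hn : 1 ≤ n) (A : HH n →L[ℝ] HH n) (x : Fin n → ℝ) :
    (A (pr hn x) : E n) = ∑ i, x i • vv hn A i := by
  have : x = ∑ i, x i • (Pi.single i 1 : Fin n → ℝ) := by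
    ext j; simp [Finset.sum_apply, Pi.single_apply]
  conv_lhs => rw [this]
  simp only [map_sum, map_smul, Submodule.coe_sum, Submodule.coe_smul, vv]

lemma vv_sum (hn : 1 ≤ n) (A : HH n →L[ℝ] HH n) : ∑ i, vv hn A i = 0 := by
  have h := A_pr hn A (fun _ => 1)
  simp only [one_smul] at h
  rw [← h]
  have : (fun _ : Fin n => (1:ℝ)) = LL hn (0, 1) := by rw [LL_apply]; ext; simp
  rw [this, pr_LL]; simp

lemma vv_mem (hn : 1 ≤ n) (A : HH n →L[ℝ] HH n) (i : Fin n) : ⟪vv hn A i, theta0 n⟫ = 0 :=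
  mem_HH.mp (A (pr hn (Pi.single i 1))).2

lemma norm_QQ (hn : 1 ≤ n) (A : HH n →L[ℝ] HH n) (x : Fin n → ℝ) :
    ‖(A (pr hn x) : E n)‖ ^ 2 = QQ (fun i j => ⟪vv hn A i, vv hn A j⟫) x := by
  rw [← real_inner_self_eq_norm_sq, A_pr, sum_inner]
  unfold QQ
  refine Finset.sum_congr rfl fun i _ => ?_
  rw [inner_sum]
  refine Finset.sum_congr rfl fun j _ => ?_
  rw [real_inner_smul_left, real_inner_smul_right]; ring

lemma inner_QQ (hn : 1 ≤ n) (A : HH n →L[ℝ] HH n) (ξ : E n) (x : Fin n → ℝ) :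
    ⟪(A (pr hn x) : E n), ξ⟫ ^ 2 = QQ (fun i j => ⟪vv hn A i, ξ⟫ * ⟪vv hn A j, ξ⟫) x := by
  rw [A_pr, sum_inner, sq, Finset.sum_mul_sum]
  unfold QQ
  refine Finset.sum_congr rfl fun i _ => ?_
  refine Finset.sum_congr rfl fun j _ => ?_
  rw [real_inner_smul_left, real_inner_smul_left]; ring

theorem main_H (hp : 1 ≤ p) : ∃ C : ℝ, 0 < C ∧ ∀ n : ℕ, 2 ≤ n →
    ∀ (η : Measure (HH n)) [η.IsAddHaarMeasure] (A : HH n →L[ℝ] HH n),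
    0 < (η (KK p n)).toReal ∧ ∀ m : ℝ, m = ((η (KK p n)).toReal)⁻¹ →
    m * (∫ y in KK p n, ‖(A y : E n)‖ ^ 4 ∂η) - (m * ∫ y in KK p n, ‖(A y : E n)‖ ^ 2 ∂η) ^ 2 ≤
    C * (⨆ ξ : {ξ : E n // ‖ξ‖ = 1 ∧ ⟪ξ, theta0 n⟫ = 0},
      m * ∫ y in KK p n, ⟪(A y : E n), (ξ : E n)⟫ ^ 2 ∂η) *
      (m * ∫ y in KK p n, ‖(A y : E n)‖ ^ 2 ∂η) := by
  obtain ⟨C, hC, core⟩ := core hp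
  refine ⟨C, hC, fun n hn2 η _ A => ?_⟩
  haveI := PP_prob hp n
  have hn : 1 ≤ n := by omega
  obtain ⟨τ, hτ, hI1, hcore⟩ := core n hn2
  obtain ⟨κ, hκ, hpol⟩ := polar_real hp hn η
  have hn' : (0 : ℝ) ≤ n - 1 := by
    have : (1 : ℝ) ≤ n := by exact_mod_cast hn
    linarith
  have hAc : Continuous fun y => (A y : E n) := continuous_subtype_val.comp A.continuous
  set v := vv hn A with hv
  set I1 := II p n (fun _ => 1) with hI1d
  have G0 : 0 < Gamma ((n - 1 + (0:ℕ) : ℝ) / p + 1) := Gamma_pos_of_pos (by push_cast; positivity)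
  have G2 : 0 < Gamma ((n - 1 + (2:ℕ) : ℝ) / p + 1) := Gamma_pos_of_pos (by positivity)
  have G4 : 0 < Gamma ((n - 1 + (4:ℕ) : ℝ) / p + 1) := Gamma_pos_of_pos (by positivity)
  have hG : Gamma ((n - 1 + (2:ℕ) : ℝ) / p + 1) ^ 2 ≤
      Gamma ((n - 1 + (0:ℕ) : ℝ) / p + 1) * Gamma ((n - 1 + (4:ℕ) : ℝ) / p + 1) := by
    have := gamma_log (q := (n - 1 : ℝ) / p) (a := 2 / p) (by positivity) (by positivity)
    convert this using 3 <;> push_cast <;> ring_nf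
  have e0 := hpol 0 (fun _ => 1) continuous_const (fun _ => zero_le_one) (by simp) (Good.const 1)
  have e2 := hpol 2 (fun y => ‖(A y : E n)‖ ^ 2) (hAc.norm.pow 2) (fun _ => by positivity)
    (fun r hr y => by
      rw [map_smul, Submodule.coe_smul, norm_smul, mul_pow, Real.norm_of_nonneg hr.le])
    (by simp_rw [norm_QQ]; exact good_QQ hp _)
  have e4 := hpol 4 (fun y => ‖(A y : E n)‖ ^ 4) (hAc.norm.pow 4) (fun _ => by positivity)
    (fun r hr y => by
      rw [map_smul, Submodule.coe_smul, norm_smul, mul_pow, Real.norm_of_nonneg hr.le])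
    (by
      have : ∀ x, ‖(A (pr hn x) : E n)‖ ^ 4 = (‖(A (pr hn x) : E n)‖ ^ 2) ^ 2 := fun x => by ring
      simp_rw [this, norm_QQ]; exact (good_QQ hp _).pow 2)
  have ex : ∀ ξ : E n, _ := fun ξ => hpol 2 (fun y => ⟪(A y : E n), ξ⟫ ^ 2)
    ((hAc.inner continuous_const).pow 2) (fun _ => by positivity)
    (fun r hr y => by
      rw [map_smul, Submodule.coe_smul, real_inner_smul_left, mul_pow])
    (by simp_rw [inner_QQ]; exact good_QQ hp _)
  simp only [norm_QQ] at e2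
  have h4 : ∀ x, ‖(A (pr hn x) : E n)‖ ^ 4 = (‖(A (pr hn x) : E n)‖ ^ 2) ^ 2 := fun x => by ring
  simp only [h4, norm_QQ] at e4
  simp only [inner_QQ] at ex
  rw [← hv] at *
  have hca := hcore (fun i j => ⟪v i, v j⟫) (fun i j => real_inner_comm _ _) (fun i => by
    rw [← inner_sum, vv_sum, inner_zero_right])
  have hcx : ∀ ξ : E n, _ := fun ξ => (hcore (fun i j => ⟪v i, ξ⟫ * ⟪v j, ξ⟫)
    (fun i j => mul_comm _ _) (fun i => by
      rw [← Finset.mul_sum, ← sum_inner, vv_sum, inner_zero_left, mul_zero])).1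
  have ex' : ∀ ξ : E n, _ := fun ξ => (ex ξ).trans (congrArg _ (hcx ξ))
  obtain ⟨hc2, hc4⟩ := hca
  have hm0 : ∫ y in KK p n, (1:ℝ) ∂η = (η (KK p n)).toReal := by simp [Measure.real]
  rw [hm0] at e0
  have I4n : 0 ≤ II p n (fun x => QQ (fun i j => ⟪v i, v j⟫) x ^ 2) :=
    integral_nonneg fun x => mul_nonneg (sq_nonneg _) (abs_nonneg _)
  generalize II p n (QQ fun i j => ⟪v i, v j⟫) = I2 at *
  generalize II p n (fun x => QQ (fun i j => ⟪v i, v j⟫) x ^ 2) = I4 at *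
  generalize Gamma ((n - 1 + (0:ℕ) : ℝ) / p + 1) = g0 at *
  generalize Gamma ((n - 1 + (2:ℕ) : ℝ) / p + 1) = g2 at *
  generalize Gamma ((n - 1 + (4:ℕ) : ℝ) / p + 1) = g4 at *
  generalize (η (KK p n)).toReal = M0 at *
  generalize ∫ y in KK p n, ‖(A y : E n)‖ ^ 2 ∂η = M2 at *
  generalize ∫ y in KK p n, ‖(A y : E n)‖ ^ 4 ∂η = M4 at *
  change g0 * M0 = κ * I1 at e0
  change g2 * M2 = κ * I2 at e2
  change g4 * M4 = κ * I4 at e4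
  have hM0 : M0 = κ * I1 / g0 := by field_simp; linarith
  have hM2 : M2 = κ * I2 / g2 := by field_simp; linarith
  have hM4 : M4 = κ * I4 / g4 := by field_simp; linarith
  have M0pos : 0 < M0 := by rw [hM0]; positivity
  refine ⟨M0pos, fun m hm => ?_⟩
  have Ex : ∀ ξ : E n, m * ∫ y in KK p n, ⟪(A y : E n), ξ⟫ ^ 2 ∂η =
      (g0 / g2 * (τ / I1)) * ∑ i, ⟪v i, ξ⟫ ^ 2 := by
    intro ξ
    have := ex' ξ
    have h2 : ∫ y in KK p n, ⟪(A y : E n), ξ⟫ ^ 2 ∂η = κ * (τ * ∑ i, ⟪v i, ξ⟫ ^ 2) / g2 := by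
      rw [eq_div_iff G2.ne', mul_comm]
      simpa only [sq] using this
    rw [h2, hm, hM0]; field_simp
  simp_rw [Ex]
  have E2 : m * M2 = g0 / g2 * (τ / I1) * ∑ i, ‖v i‖ ^ 2 := by
    rw [hm, hM0, hM2, hc2]; simp_rw [real_inner_self_eq_norm_sq]; field_simp
  have hbase : m * M4 - (m * M2) ^ 2 ≤ C * (g0 / g2 * (τ / I1)) ^ 2 * ∑ i, ∑ j, ⟪v i, v j⟫ ^ 2 := by
    have a1 : m * M4 ≤ (g0 / g2) ^ 2 * (I4 / I1) := by
      have : m * M4 = g0 / g4 * (I4 / I1) := by rw [hm, hM0, hM4]; field_simp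
      rw [this]
      gcongr
      rw [div_pow, div_le_div_iff₀ G4 (by positivity)]
      nlinarith
    have a2 : m * M2 = (g0 / g2) * (I2 / I1) := by rw [hm, hM0, hM2]; field_simp
    rw [a2]
    calc _ ≤ (g0 / g2) ^ 2 * (I4 / I1) - (g0 / g2 * (I2 / I1)) ^ 2 := by linarith
      _ = (g0 / g2) ^ 2 * (I4 * I1 - I2 ^ 2) / I1 ^ 2 := by field_simp
      _ ≤ (g0 / g2) ^ 2 * (C * τ ^ 2 * ∑ i, ∑ j, ⟪v i, v j⟫ ^ 2) / I1 ^ 2 := by gcongr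
      _ = _ := by field_simp
  refine hbase.trans ?_
  rw [E2]
  set w := g0 / g2 * (τ / I1) with hw
  have wpos : 0 < w := by positivity
  set s := ⨆ ξ : {ξ : E n // ‖ξ‖ = 1 ∧ ⟪ξ, theta0 n⟫ = 0}, w * ∑ i, ⟪v i, (ξ : E n)⟫ ^ 2 with hs
  have hbdd : BddAbove (Set.range fun ξ : {ξ : E n // ‖ξ‖ = 1 ∧ ⟪ξ, theta0 n⟫ = 0} =>
      w * ∑ i, ⟪v i, (ξ : E n)⟫ ^ 2) := by
    refine ⟨w * ∑ i, ‖v i‖ ^ 2, ?_⟩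
    rintro _ ⟨ξ, rfl⟩
    dsimp only
    refine mul_le_mul_of_nonneg_left (Finset.sum_le_sum fun i _ => ?_) wpos.le
    have := abs_real_inner_le_norm (v i) (ξ : E n)
    rw [ξ.2.1, mul_one] at this
    rw [← sq_abs]
    gcongr
  have key : ∀ i, w * ∑ j, ⟪v i, v j⟫ ^ 2 ≤ s * ‖v i‖ ^ 2 := by
    intro i
    by_cases h0 : v i = 0
    · simp [h0]
    have hpos : 0 < ‖v i‖ := norm_pos_iff.mpr h0
    have := le_ciSup hbdd ⟨(‖v i‖)⁻¹ • v i, by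
      rw [norm_smul, norm_inv, norm_norm, inv_mul_cancel₀ hpos.ne'], by
      rw [real_inner_smul_left, vv_mem, mul_zero]⟩
    rw [← hs] at this
    simp only [real_inner_smul_right, mul_pow] at this
    rw [← Finset.mul_sum] at this
    calc w * ∑ j, ⟪v i, v j⟫ ^ 2 = (w * ((‖v i‖)⁻¹ ^ 2 * ∑ j, ⟪v j, v i⟫ ^ 2)) * ‖v i‖ ^ 2 := by
          simp_rw [real_inner_comm (v i)]
          field_simp
      _ ≤ _ := by gcongr
  calc C * w ^ 2 * ∑ i, ∑ j, ⟪v i, v j⟫ ^ 2 = C * w * ∑ i, w * ∑ j, ⟪v i, v j⟫ ^ 2 := by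
        rw [← Finset.mul_sum]; ring
    _ ≤ C * w * ∑ i, s * ‖v i‖ ^ 2 := 
        mul_le_mul_of_nonneg_left (Finset.sum_le_sum fun i _ => key i) (by positivity)
    _ = _ := by rw [← Finset.mul_sum]; ring

end Fin

section Haus
variable {p : ℝ} {n : ℕ}

/-- restriction of `T` to the hyperplane -/
lemma exists_TH (T : E n ≃ₗ[ℝ] E n) (hT : ∀ x : E n, ⟪x, theta0 n⟫ = 0 → ⟪T x, theta0 n⟫ = 0) :
    ∃ S : HH n ≃L[ℝ] HH n, ∀ y, (S y : E n) = T y := by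
  let f : HH n →ₗ[ℝ] HH n := T.toLinearMap.restrict (p := HH n) (q := HH n)
    (fun x hx => mem_HH.mpr (hT x (mem_HH.mp hx)))
  have hf : Function.Injective f := fun a b hab => by
    have := congrArg Subtype.val hab
    exact Subtype.ext (T.injective this)
  exact ⟨(LinearEquiv.ofInjectiveEndo f hf).toContinuousLinearEquiv, fun y => rfl⟩

lemma haus_haar (hn : 1 ≤ n) : (μH[(n : ℝ) - 1] : Measure (HH n)).IsAddHaarMeasure := by
  have h : ((Module.finrank ℝ (HH n) : ℕ) : ℝ) = n - 1 := by
    rw [eq_sub_iff_add_eq]; exact_mod_cast finrank_HH hn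
  rw [← h]; infer_instance

lemma unif_eq (hp : 1 ≤ p) (hn : 1 ≤ n) (T : E n ≃ₗ[ℝ] E n) (S : HH n ≃L[ℝ] HH n)
    (hS : ∀ y, (S y : E n) = T y) :
    ∃ η : Measure (HH n), η.IsAddHaarMeasure ∧ ∀ f : E n → ℝ, Continuous f →
      ∫ x, f x ∂(unifH ((n : ℝ) - 1) ((fun x => T x) '' (projPerp (theta0 n) '' lpBall n p))) =
      ((η (KK p n)).toReal)⁻¹ * ∫ y in KK p n, f (S y) ∂η := by
  haveI := haus_haar hn
  set μ : Measure (HH n) := μH[(n : ℝ) - 1] with hμ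
  refine ⟨μ.map S.symm, S.symm.isAddHaarMeasure_map μ, fun f hf => ?_⟩
  set K := (fun x => T x) '' (projPerp (theta0 n) '' lpBall n p) with hK
  have hd : (0 : ℝ) ≤ n - 1 := by
    have : (1 : ℝ) ≤ n := by exact_mod_cast hn
    linarith
  let e : HH n → E n := fun y => (S y : E n)
  have hec : Continuous e := continuous_subtype_val.comp S.continuous
  have hei : Function.Injective e := Subtype.val_injective.comp S.injective
  have hKe : K = e '' KK p n := by
    rw [hK, KK_image hn, Set.image_image]
    refine Set.image_congr fun y _ => (hS y).symm
  have hKm : MeasurableSet K := by rw [hKe]; exact ((KK_compact hp hn).image hec).measurableSet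
  have hm : (μ.map S.symm).map e = μH[(n : ℝ) - 1].restrict (HH n : Set (E n)) := by
    rw [Measure.map_map hec.measurable S.symm.continuous.measurable]
    have : e ∘ S.symm = Subtype.val := by ext y; simp [e]
    rw [this, hμ, (isometry_subtype_coe).map_hausdorffMeasure (Or.inl hd)]
    simp
  have hpre : e ⁻¹' K = KK p n := by rw [hKe, Set.preimage_image_eq _ hei]
  have hr : μH[(n : ℝ) - 1].restrict K = ((μ.map S.symm).restrict (KK p n)).map e := by
    rw [← hpre, ← Measure.restrict_map hec.measurable hKm, hm, Measure.restrict_restrict hKm,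
      Set.inter_eq_left.mpr]
    rw [hKe]; rintro _ ⟨y, _, rfl⟩; exact (S y).2
  have hv : μH[(n : ℝ) - 1] K = (μ.map S.symm) (KK p n) := by
    have := congrArg (fun ν => ν Set.univ) hr
    simp only [Measure.restrict_apply_univ] at this
    rw [this, Measure.map_apply hec.measurable MeasurableSet.univ]; simp
  unfold unifH
  rw [integral_smul_measure, hv, hr, integral_map hec.aemeasurable hf.aestronglyMeasurable,
    ENNReal.toReal_inv, smul_eq_mul]

lemma small (hn : n < 2) (T : E n ≃ₗ[ℝ] E n) (d p : ℝ) (k : ℕ) (hk : k ≠ 0) :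
    ∫ x, ‖x‖ ^ k ∂(unifH d ((fun x => T x) '' (projPerp (theta0 n) '' lpBall n p))) = 0 := by
  have h0 : ∀ x : E n, projPerp (theta0 n) x = 0 := by
    intro x
    interval_cases n
    · exact Subsingleton.elim _ _
    · ext i
      fin_cases i
      simp [projPerp, theta0, inner_theta, PiLp.inner_apply]
  have hK : ((fun x => T x) '' (projPerp (theta0 n) '' lpBall n p)) ⊆ {0} := by
    rintro _ ⟨_, ⟨x, _, rfl⟩, rfl⟩
    simp [h0]
  have hK' : ((fun x => T x) '' (projPerp (theta0 n) '' lpBall n p)) = ∅ ∨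
     ((fun x => T x) '' (projPerp (theta0 n) '' lpBall n p)) = {0} := Set.subset_singleton_iff_eq.mp hK
  unfold unifH
  rw [integral_smul_measure]
  rcases hK' with h | h
  · rw [h]; simp
  · rw [h]
    have : ∫ x in ({0} : Set (E n)), ‖x‖ ^ k ∂μH[d] = 0 := by
      rw [setIntegral_congr_fun (g := fun _ => (0:ℝ)) (measurableSet_singleton _)]
      · simp
      · intro x hx; simp only [Set.mem_singleton_iff] at hx; simp [hx, hk]
    rw [this, smul_zero]

end Haus

end VC

/-- (General Variance Conjecture for linear images of `P_{θ₀⊥}B_p^n`.)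
For every `p ≥ 1` there is `C(p) > 0` such that for every `n`, every linear isomorphism `T`
of the hyperplane `θ₀⊥`, and a random vector `X` uniformly distributed on `T(P_{θ₀⊥}B_p^n)`,
one has `Var |X|² ≤ C(p) λ_X² E|X|²`. -/
theorem variance_conjecture_proj (p : ℝ) (hp : 1 ≤ p) :
    ∃ C : ℝ, 0 < C ∧ ∀ n : ℕ, ∀ T : E n ≃ₗ[ℝ] E n,
      (∀ x : E n, ⟪x, theta0 n⟫ = 0 → ⟪T x, theta0 n⟫ = 0) →
      (∫ x, ‖x‖ ^ 4 ∂(unifH ((n : ℝ) - 1)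
            ((fun x => T x) '' (projPerp (theta0 n) '' lpBall n p)))) -
        (∫ x, ‖x‖ ^ 2 ∂(unifH ((n : ℝ) - 1)
            ((fun x => T x) '' (projPerp (theta0 n) '' lpBall n p)))) ^ 2 ≤
      C * (⨆ ξ : {ξ : E n // ‖ξ‖ = 1 ∧ ⟪ξ, theta0 n⟫ = 0},
              ∫ x, ⟪x, (ξ : E n)⟫ ^ 2 ∂(unifH ((n : ℝ) - 1)
                ((fun x => T x) '' (projPerp (theta0 n) '' lpBall n p)))) *
        (∫ x, ‖x‖ ^ 2 ∂(unifH ((n : ℝ) - 1)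
            ((fun x => T x) '' (projPerp (theta0 n) '' lpBall n p)))) := by
  obtain ⟨C, hC, h⟩ := VC.main_H hp
  refine ⟨C, hC, fun n T hT => ?_⟩
  by_cases hn : n < 2
  · rw [VC.small hn T _ p 4 (by norm_num), VC.small hn T _ p 2 (by norm_num)]
    simp
  push Not at hn
  obtain ⟨S, hS⟩ := VC.exists_TH T hT
  obtain ⟨η, hη, h_unif⟩ := VC.unif_eq (p := p) hp (by omega : 1 ≤ n) T S hS
  obtain ⟨_, hmain⟩ := h n hn η (S : VC.HH n →L[ℝ] VC.HH n)
  have := hmain _ rfl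
  rw [h_unif (fun x => ‖x‖ ^ 4) (by fun_prop), h_unif (fun x => ‖x‖ ^ 2) (by fun_prop)]
  have hx : ∀ ξ : E n, _ := fun ξ => h_unif (fun x => ⟪x, ξ⟫ ^ 2)
    ((continuous_id.inner continuous_const).pow 2)
  simp_rw [hx]
  exact this
end
end

section
/- Let n ≥ 2, p ≥ 1, and let X be a random vector uniformly distributed on the ℓ_p unit ball B_p^n. Set ξ1 = (e1+e2)/√2, ξ2 = (e1−e2)/√2, f(η1,η2) = E[⟨X,η1⟩²⟨X,η2⟩²] − E[⟨X,η1⟩²]·E[⟨X,η2⟩²], and F(x) = Γ(5x)Γ(x)/Γ(3x)². Then f(e1,e2) = [Γ(1+n/p)·Γ(3/p)² / (Γ(1+(n+4)/p)·Γ(1/p)²)] · (1 − Γ(1+n/p)·Γ(1+(n+4)/p)/Γ(1+(n+2)/p)²) and f(ξ1,ξ2) = [Γ(1+n/p)·Γ(3/p)² / (2·Γ(1+(n+4)/p)·Γ(1/p)²)] · (F(1/p) − 1 − 2·Γ(1+n/p)·Γ(1+(n+4)/p)/Γ(1+(n+2)/p)²). -/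
open MeasureTheory Real
open scoped RealInnerProductSpace ENNReal

noncomputable section

/-- The uniform probability measure (normalized Lebesgue measure) on a set `K ⊆ ℝⁿ`. -/
def unif {n : ℕ} (K : Set (E n)) : Measure (E n) := (volume K)⁻¹ • volume.restrict K

namespace CovAux

/-- The sum of the `p`-th powers. -/
def gp {n : ℕ} (p : ℝ) (x : Fin n → ℝ) : ℝ := ∑ i, |x i| ^ p

lemma gp_nonneg {n : ℕ} (p : ℝ) (x : Fin n → ℝ) : 0 ≤ gp p x :=
  Finset.sum_nonneg fun _ _ => rpow_nonneg (abs_nonneg _) _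

lemma measurable_gp {n : ℕ} (p : ℝ) : Measurable (gp (n := n) p) := by
  unfold gp
  fun_prop

lemma gp_smul {n : ℕ} (p : ℝ) {r : ℝ} (hr : 0 < r) (x : Fin n → ℝ) :
    gp p (r • x) = r ^ p * gp p x := by
  simp only [gp, Finset.mul_sum, Pi.smul_apply, smul_eq_mul, abs_mul]
  refine Finset.sum_congr rfl fun i _ => ?_
  rw [mul_rpow (abs_nonneg _) (abs_nonneg _), abs_of_pos hr]

/-- scaling of the sublevel integrals -/
lemma scaling {n : ℕ} {p : ℝ} (hp : 0 < p) (d : ℕ) (H : (Fin n → ℝ) → ℝ≥0∞)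
    (hH : Measurable H)
    (hom : ∀ r : ℝ, 0 < r → ∀ x, H (r • x) = ENNReal.ofReal (r ^ d) * H x) {t : ℝ} (ht : 0 < t) :
    ∫⁻ x in {x | gp p x ≤ t}, H x =
      ENNReal.ofReal (t ^ (((n : ℝ) + d) / p)) * ∫⁻ x in {x | gp p x ≤ 1}, H x := by
  have hms : ∀ s : ℝ, MeasurableSet {x : Fin n → ℝ | gp p x ≤ s} := fun s =>
    measurableSet_le (measurable_gp p) measurable_const
  set r : ℝ := t ^ (1 / p) with hr
  have hr0 : 0 < r := rpow_pos_of_pos ht _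
  have hrp : r ^ p = t := by
    rw [hr, ← rpow_mul ht.le, one_div_mul_cancel hp.ne', rpow_one]
  have h1 : ∫⁻ x, ({x | gp p x ≤ t}.indicator H) (r • x) =
      ENNReal.ofReal ((r ^ n)⁻¹) * ∫⁻ x in {x | gp p x ≤ t}, H x := by
    have := lintegral_map (μ := (volume : Measure (Fin n → ℝ))) (hH.indicator (hms t))
      (measurable_const_smul r)
    rw [← this, Measure.map_addHaar_smul _ hr0.ne', lintegral_smul_measure,
      lintegral_indicator (hms t)]
    simp [abs_of_pos hr0]
  have h2 : ∫⁻ x, ({x | gp p x ≤ t}.indicator H) (r • x) =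
      ENNReal.ofReal (r ^ d) * ∫⁻ x in {x | gp p x ≤ 1}, H x := by
    rw [← lintegral_indicator (hms 1), ← lintegral_const_mul _ (hH.indicator (hms 1))]
    refine lintegral_congr fun x => ?_
    have : gp p (r • x) ≤ t ↔ gp p x ≤ 1 := by
      rw [gp_smul p hr0, hrp]
      constructor
      · intro h
        by_contra! h'
        nlinarith
      · intro h
        nlinarith
    by_cases hx : gp p x ≤ 1
    · rw [Set.indicator_of_mem (by exact this.2 hx), Set.indicator_of_mem (by exact hx), hom r hr0]
    · rw [Set.indicator_of_notMem (by exact fun h => hx (this.1 h)),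
        Set.indicator_of_notMem (by exact hx), mul_zero]
  have h3 : t ^ (((n : ℝ) + d) / p) = r ^ n * r ^ d := by
    rw [hr, ← pow_add, ← rpow_natCast, ← rpow_mul ht.le]
    congr 1
    push_cast
    field_simp
  have h4 : ENNReal.ofReal (r ^ n) * ENNReal.ofReal ((r ^ n)⁻¹) = 1 := by
    rw [← ENNReal.ofReal_mul (by positivity), mul_inv_cancel₀ (by positivity), ENNReal.ofReal_one]
  rw [h3, ENNReal.ofReal_mul (by positivity), mul_assoc, ← h2, h1, ← mul_assoc, h4, one_mul]

lemma exp_tail (s : ℝ) (hs : 0 ≤ s) :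
    ENNReal.ofReal (exp (-s)) =
      ∫⁻ t in Set.Ioi (0:ℝ), {t | s ≤ t}.indicator (fun t => ENNReal.ofReal (exp (-t))) t := by
  have hint : IntegrableOn (fun t : ℝ => exp (-t)) (Set.Ioi s) := integrableOn_exp_neg_Ioi s
  rw [← integral_exp_neg_Ioi s, ofReal_integral_eq_lintegral_ofReal hint
    (Filter.Eventually.of_forall fun t => (exp_pos _).le)]
  have hmI : MeasurableSet {t : ℝ | s ≤ t} := measurableSet_Ici
  rw [lintegral_indicator hmI, Measure.restrict_restrict hmI]
  refine setLIntegral_congr ?_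
  rcases hs.eq_or_lt with rfl | h
  · have : {t : ℝ | 0 ≤ t} ∩ Set.Ioi 0 = Set.Ioi 0 := by
      ext t; simp; exact le_of_lt
    rw [this]
    exact Filter.EventuallyEq.rfl
  · have : {t : ℝ | s ≤ t} ∩ Set.Ioi 0 = Set.Ici s := by
      ext t; simp; intro h'; linarith
    rw [this]
    exact Ioi_ae_eq_Ici

lemma gamma_lint (a : ℝ) (ha : 0 ≤ a) :
    ∫⁻ t in Set.Ioi (0:ℝ), ENNReal.ofReal (exp (-t)) * ENNReal.ofReal (t ^ a) =
      ENNReal.ofReal (Real.Gamma (1 + a)) := by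
  have h := Real.GammaIntegral_convergent (s := 1 + a) (by linarith)
  rw [Real.Gamma_eq_integral (by linarith), ofReal_integral_eq_lintegral_ofReal h]
  · refine lintegral_congr fun t => ?_
    rw [← ENNReal.ofReal_mul (exp_pos _).le, add_sub_cancel_left]
  · filter_upwards [ae_restrict_mem measurableSet_Ioi] with t ht
    exact mul_nonneg (exp_pos _).le (rpow_nonneg (le_of_lt ht) _)

lemma polar {n : ℕ} {p : ℝ} (hp : 0 < p) (d : ℕ) (H : (Fin n → ℝ) → ℝ≥0∞)
    (hH : Measurable H)
    (hom : ∀ r : ℝ, 0 < r → ∀ x, H (r • x) = ENNReal.ofReal (r ^ d) * H x) :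
    ∫⁻ x, H x * ENNReal.ofReal (exp (-gp p x)) =
      ENNReal.ofReal (Real.Gamma (1 + ((n : ℝ) + d) / p)) * ∫⁻ x in {x | gp p x ≤ 1}, H x := by
  have hms : ∀ s : ℝ, MeasurableSet {x : Fin n → ℝ | gp p x ≤ s} := fun s =>
    measurableSet_le (measurable_gp p) measurable_const
  have hmeas2 : Measurable (fun q : (Fin n → ℝ) × ℝ =>
      H q.1 * {q : (Fin n → ℝ) × ℝ | gp p q.1 ≤ q.2}.indicator
        (fun q => ENNReal.ofReal (exp (-q.2))) q) := by
    refine (hH.comp measurable_fst).mul (Measurable.indicator (by fun_prop) ?_)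
    exact measurableSet_le ((measurable_gp p).comp measurable_fst) measurable_snd
  calc ∫⁻ x, H x * ENNReal.ofReal (exp (-gp p x))
      = ∫⁻ x, ∫⁻ t in Set.Ioi (0:ℝ), H x * {q : (Fin n → ℝ) × ℝ | gp p q.1 ≤ q.2}.indicator
        (fun q => ENNReal.ofReal (exp (-q.2))) (x, t) := by
        refine lintegral_congr fun x => ?_
        rw [exp_tail _ (gp_nonneg p x), ← lintegral_const_mul]
        · rfl
        · exact Measurable.indicator (by fun_prop) measurableSet_Ici
    _ = ∫⁻ t in Set.Ioi (0:ℝ), ∫⁻ x, H x * {q : (Fin n → ℝ) × ℝ | gp p q.1 ≤ q.2}.indicator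
        (fun q => ENNReal.ofReal (exp (-q.2))) (x, t) :=
        lintegral_lintegral_swap hmeas2.aemeasurable
    _ = ∫⁻ t in Set.Ioi (0:ℝ), ENNReal.ofReal (exp (-t)) * ENNReal.ofReal (t ^ (((n : ℝ) + d) / p))
          * ∫⁻ x in {x | gp p x ≤ 1}, H x := by
        refine setLIntegral_congr_fun measurableSet_Ioi fun t ht => ?_
        rw [mul_assoc, ← scaling hp d H hH hom ht, ← lintegral_indicator (hms t),
          ← lintegral_const_mul _ (hH.indicator (hms t))]
        refine lintegral_congr fun x => ?_
        by_cases hx : gp p x ≤ t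
        · rw [Set.indicator_of_mem (by exact hx), Set.indicator_of_mem (by exact hx), mul_comm]
        · rw [Set.indicator_of_notMem (by exact hx), Set.indicator_of_notMem (by exact hx)]
          simp
    _ = _ := by
        rw [lintegral_mul_const _ (by fun_prop), gamma_lint _ (by positivity)]

lemma one_dim {p : ℝ} (hp : 0 < p) (a : ℕ) :
    ∫ x : ℝ, x ^ (2 * a) * exp (-|x| ^ p) = 2 / p * Real.Gamma ((2 * a + 1) / p) := by
  have h := integral_comp_abs (f := fun x => x ^ (2 * a) * exp (-x ^ p))
  have h2 : ∀ x : ℝ, |x| ^ (2 * a) = x ^ (2 * a) := fun x => by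
    rw [pow_mul, sq_abs, ← pow_mul]
  simp only [h2] at h
  rw [h]
  have h3 := integral_rpow_mul_exp_neg_rpow (p := p) (q := (2 * a : ℕ)) hp
    (lt_of_lt_of_le (by norm_num) (Nat.cast_nonneg _))
  simp only [rpow_natCast] at h3
  rw [h3]
  push_cast
  ring

lemma one_dim_pos {p : ℝ} (hp : 0 < p) (a : ℕ) : 0 < 2 / p * Real.Gamma ((2 * a + 1) / p) :=
  mul_pos (by positivity) (Real.Gamma_pos_of_pos (by positivity))

lemma one_dim_integrable {p : ℝ} (hp : 0 < p) (a : ℕ) :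
    Integrable (fun x : ℝ => x ^ (2 * a) * exp (-|x| ^ p)) := by
  by_contra h
  have := integral_undef h
  rw [one_dim hp a] at this
  exact (one_dim_pos hp a).ne' this

/-- even monomials -/
def mono {m : ℕ} (a b : ℕ) (x : Fin (m + 2) → ℝ) : ℝ := x 0 ^ (2 * a) * x 1 ^ (2 * b)

lemma mono_nonneg {m : ℕ} (a b : ℕ) (x : Fin (m + 2) → ℝ) : 0 ≤ mono a b x := by
  unfold mono
  rw [pow_mul, pow_mul]
  positivity

lemma mono_measurable {m : ℕ} (a b : ℕ) : Measurable (mono (m := m) a b) := by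
  unfold mono
  fun_prop

lemma mono_prod {m : ℕ} (p : ℝ) (a b : ℕ) (x : Fin (m + 2) → ℝ) :
    mono a b x * exp (-gp p x) =
      ∏ i, (x i ^ (2 * (Fin.cons a (Fin.cons b fun _ => 0) : Fin (m + 2) → ℕ) i) *
        exp (-|x i| ^ p)) := by
  rw [Finset.prod_mul_distrib, ← exp_sum, Finset.sum_neg_distrib]
  congr 1
  simp [mono, Fin.prod_univ_succ]

/-- total mass on the whole space -/
def tot (m : ℕ) (p : ℝ) (a b : ℕ) : ℝ :=
  (2 / p * Real.Gamma ((2 * a + 1) / p)) * ((2 / p * Real.Gamma ((2 * b + 1) / p)) *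
    (2 / p * Real.Gamma (1 / p)) ^ m)

lemma full_integral {m : ℕ} {p : ℝ} (hp : 0 < p) (a b : ℕ) :
    ∫ x : Fin (m + 2) → ℝ, mono a b x * exp (-gp p x) = tot m p a b := by
  simp only [mono_prod]
  rw [integral_fintype_prod_volume_eq_prod
    (f := fun i (y : ℝ) => y ^ (2 * (Fin.cons a (Fin.cons b fun _ => 0) : Fin (m + 2) → ℕ) i) *
        exp (-|y| ^ p))]
  simp only [one_dim hp]
  simp [tot, Fin.prod_univ_succ]

lemma tot_pos (m : ℕ) {p : ℝ} (hp : 0 < p) (a b : ℕ) : 0 < tot m p a b := by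
  have := one_dim_pos hp 0
  simp only [Nat.cast_zero, mul_zero, zero_add] at this
  exact mul_pos (one_dim_pos hp a) (mul_pos (one_dim_pos hp b) (pow_pos this m))

lemma full_integrable {m : ℕ} {p : ℝ} (hp : 0 < p) (a b : ℕ) :
    Integrable (fun x : Fin (m + 2) → ℝ => mono a b x * exp (-gp p x)) := by
  by_contra h
  have := integral_undef h
  rw [full_integral hp a b] at this
  exact (tot_pos m hp a b).ne' this

lemma ball_lint {m : ℕ} {p : ℝ} (hp : 0 < p) (a b : ℕ) :
    ∫⁻ x in {x : Fin (m + 2) → ℝ | gp p x ≤ 1}, ENNReal.ofReal (mono a b x) =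
      ENNReal.ofReal (tot m p a b /
        Real.Gamma (1 + (((m + 2 : ℕ) : ℝ) + (2 * a + 2 * b : ℕ)) / p)) := by
  have hG : 0 < Real.Gamma (1 + (((m + 2 : ℕ) : ℝ) + (2 * a + 2 * b : ℕ)) / p) :=
    Real.Gamma_pos_of_pos (by positivity)
  have h := polar (n := m + 2) hp (2 * a + 2 * b) (fun x => ENNReal.ofReal (mono a b x))
    (mono_measurable a b).ennreal_ofReal (by
      intro r hr x
      rw [← ENNReal.ofReal_mul (by positivity)]
      congr 1
      simp only [mono, Pi.smul_apply, smul_eq_mul]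
      ring)
  simp only [← ENNReal.ofReal_mul (mono_nonneg a b _)] at h
  rw [← ofReal_integral_eq_lintegral_ofReal (full_integrable hp a b)
    (Filter.Eventually.of_forall fun x => mul_nonneg (mono_nonneg a b x) (exp_pos _).le),
    full_integral hp] at h
  rw [ENNReal.ofReal_div_of_pos hG, h, mul_comm, ENNReal.mul_div_cancel_right]
  · simpa using hG
  · simp

lemma ball_integrable {m : ℕ} {p : ℝ} (hp : 0 < p) (a b : ℕ) :
    IntegrableOn (mono a b) {x : Fin (m + 2) → ℝ | gp p x ≤ 1} := by
  refine ⟨(mono_measurable a b).aestronglyMeasurable, ?_⟩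
  rw [hasFiniteIntegral_iff_ofReal (Filter.Eventually.of_forall (mono_nonneg a b)), ball_lint hp]
  simp

lemma ball_integral {m : ℕ} {p : ℝ} (hp : 0 < p) (a b : ℕ) :
    ∫ x in {x : Fin (m + 2) → ℝ | gp p x ≤ 1}, mono a b x =
      tot m p a b / Real.Gamma (1 + (((m + 2 : ℕ) : ℝ) + (2 * a + 2 * b : ℕ)) / p) := by
  have hG : 0 < Real.Gamma (1 + (((m + 2 : ℕ) : ℝ) + (2 * a + 2 * b : ℕ)) / p) :=
    Real.Gamma_pos_of_pos (by positivity)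
  rw [integral_eq_lintegral_of_nonneg_ae (Filter.Eventually.of_forall (mono_nonneg a b))
    (mono_measurable a b).aestronglyMeasurable, ball_lint hp, ENNReal.toReal_ofReal]
  exact (div_pos (tot_pos m hp a b) hG).le

lemma ball_cross_integrable {m : ℕ} {p : ℝ} (hp : 0 < p) :
    IntegrableOn (fun x => x 0 * x 1) {x : Fin (m + 2) → ℝ | gp p x ≤ 1} := by
  refine Integrable.mono' ((ball_integrable hp 1 0).add (ball_integrable hp 0 1))
    (by fun_prop) (Filter.Eventually.of_forall fun x => ?_)
  simp only [mono, Pi.add_apply, Real.norm_eq_abs]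
  norm_num
  rw [← sq_abs (x 0), ← sq_abs (x 1)]
  nlinarith [sq_nonneg (|x 0| - |x 1|), sq_nonneg (|x 0|), sq_nonneg (|x 1|)]

lemma ball_cross {m : ℕ} {p : ℝ} :
    ∫ x in {x : Fin (m + 2) → ℝ | gp p x ≤ 1}, x 0 * x 1 = 0 := by
  have hms : MeasurableSet {x : Fin (m + 2) → ℝ | gp p x ≤ 1} :=
    measurableSet_le (measurable_gp p) measurable_const
  let e : (Fin (m + 2) → ℝ) ≃ᵐ (Fin (m + 2) → ℝ) :=
    MeasurableEquiv.piCongrRight fun i => if i = 0 then MeasurableEquiv.neg ℝ else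
      MeasurableEquiv.refl ℝ
  have he : ∀ x i, e x i = if i = 0 then - x i else x i := by
    intro x i
    change (if i = 0 then MeasurableEquiv.neg ℝ else MeasurableEquiv.refl ℝ) (x i) = _
    split_ifs <;> rfl
  have hmp : MeasurePreserving e := by
    refine volume_preserving_pi (f := fun i => ⇑(if i = 0 then MeasurableEquiv.neg ℝ else
      MeasurableEquiv.refl ℝ)) fun i => ?_
    split_ifs
    · exact Measure.measurePreserving_neg _
    · exact MeasurePreserving.id _
  have hpre : e ⁻¹' {x | gp p x ≤ 1} = {x | gp p x ≤ 1} := by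
    ext x
    simp only [Set.mem_preimage, Set.mem_ofPred_eq, gp, he]
    have : ∀ i, |if i = 0 then -x i else x i| = |x i| := by
      intro i; split_ifs <;> simp
    simp only [this]
  have h := hmp.setIntegral_preimage_emb e.measurableEmbedding (fun x => x 0 * x 1)
    {x | gp p x ≤ 1}
  rw [hpre] at h
  simp only [he] at h
  norm_num [integral_neg] at h
  linarith

/-- transfer to Euclidean space -/
lemma unif_integral {m : ℕ} {p : ℝ} (hp : 0 < p) (f : E (m + 2) → ℝ) :
    ∫ x, f x ∂(unif (lpBall (m + 2) p)) =
      (Real.Gamma (1 + ((m + 2 : ℕ) : ℝ) / p) / tot m p 0 0) *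
        ∫ x in {x : Fin (m + 2) → ℝ | gp p x ≤ 1}, f (WithLp.toLp 2 x) := by
  have hmp := PiLp.volume_preserving_toLp (Fin (m + 2))
  have hemb : MeasurableEmbedding (@WithLp.toLp 2 (Fin (m + 2) → ℝ)) :=
    (MeasurableEquiv.toLp 2 (Fin (m + 2) → ℝ)).measurableEmbedding
  have hpre : (@WithLp.toLp 2 (Fin (m + 2) → ℝ)) ⁻¹' (lpBall (m + 2) p) = {x | gp p x ≤ 1} := rfl
  have hvol : volume (lpBall (m + 2) p) =
      ENNReal.ofReal (tot m p 0 0 / Real.Gamma (1 + ((m + 2 : ℕ) : ℝ) / p)) := by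
    rw [← hmp.measure_preimage_emb hemb, hpre]
    have := ball_lint (m := m) hp 0 0
    simpa [mono] using this
  have hG : 0 < Real.Gamma (1 + ((m + 2 : ℕ) : ℝ) / p) :=
    Real.Gamma_pos_of_pos (by positivity)
  have hpos : 0 < tot m p 0 0 / Real.Gamma (1 + ((m + 2 : ℕ) : ℝ) / p) :=
    div_pos (tot_pos m hp 0 0) hG
  rw [unif, integral_smul_measure, hvol, ← hpre, hmp.setIntegral_preimage_emb hemb,
    ENNReal.toReal_inv, ENNReal.toReal_ofReal hpos.le, inv_div, smul_eq_mul]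

lemma inner_stdb {m : ℕ} (x : Fin (m + 2) → ℝ) (i : Fin (m + 2)) :
    ⟪(WithLp.toLp 2 x : E (m + 2)), stdb i⟫ = x i := by
  simp [stdb, EuclideanSpace.inner_single_right]

/-- normalized even moments -/
def mom (m : ℕ) (p : ℝ) (a b : ℕ) : ℝ :=
  (Real.Gamma (1 + ((m + 2 : ℕ) : ℝ) / p) / tot m p 0 0) *
    (tot m p a b / Real.Gamma (1 + (((m + 2 : ℕ) : ℝ) + (2 * a + 2 * b : ℕ)) / p))

lemma mom_eq (m : ℕ) {p : ℝ} (hp : 0 < p) (a b : ℕ) :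
    mom m p a b = Real.Gamma (1 + ((m + 2 : ℕ) : ℝ) / p) /
      Real.Gamma (1 + (((m + 2 : ℕ) : ℝ) + (2 * a + 2 * b : ℕ)) / p) *
      (Real.Gamma ((2 * a + 1) / p) * Real.Gamma ((2 * b + 1) / p) / Real.Gamma (1 / p) ^ 2) := by
  have h1 : Real.Gamma (1 / p) ≠ 0 := (Real.Gamma_pos_of_pos (by positivity)).ne'
  have h2 : Real.Gamma (1 + (((m + 2 : ℕ) : ℝ) + (2 * a + 2 * b : ℕ)) / p) ≠ 0 :=
    (Real.Gamma_pos_of_pos (by positivity)).ne'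
  unfold mom tot
  simp only [Nat.cast_zero, mul_zero, zero_add]
  generalize Real.Gamma (1 / p) = g at *
  generalize Real.Gamma (1 + (((m + 2 : ℕ) : ℝ) + (2 * a + 2 * b : ℕ)) / p) = G at *
  field_simp

lemma E_mono {m : ℕ} {p : ℝ} (hp : 0 < p) (a b : ℕ) (f : E (m + 2) → ℝ)
    (hf : ∀ x : Fin (m + 2) → ℝ, f (WithLp.toLp 2 x) = mono a b x) :
    ∫ x, f x ∂(unif (lpBall (m + 2) p)) = mom m p a b := by
  rw [unif_integral hp]
  simp only [hf]
  rw [ball_integral hp, mom]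

lemma E_quad {m : ℕ} {p : ℝ} (hp : 0 < p) (s : ℝ) (f : E (m + 2) → ℝ)
    (hf : ∀ x : Fin (m + 2) → ℝ, f (WithLp.toLp 2 x) =
      (1 / 2) * mono 1 0 x + (1 / 2) * mono 0 1 x + s * (x 0 * x 1)) :
    ∫ x, f x ∂(unif (lpBall (m + 2) p)) = (mom m p 1 0 + mom m p 0 1) / 2 := by
  rw [unif_integral hp]
  simp only [hf]
  have i1 := (ball_integrable (m := m) hp 1 0).const_mul (1 / 2)
  have i2 := (ball_integrable (m := m) hp 0 1).const_mul (1 / 2)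
  have i12 := i1.add i2
  simp only [Pi.add_def] at i12
  have i3 := (ball_cross_integrable (m := m) hp).const_mul s
  rw [integral_add i12 i3, integral_add i1 i2]
  simp only [integral_const_mul]
  rw [ball_cross, ball_integral hp, ball_integral hp, mom, mom]
  ring

lemma E_quart {m : ℕ} {p : ℝ} (hp : 0 < p) (f : E (m + 2) → ℝ)
    (hf : ∀ x : Fin (m + 2) → ℝ, f (WithLp.toLp 2 x) =
      (1 / 4) * mono 2 0 x + (1 / 4) * mono 0 2 x + (-1 / 2) * mono 1 1 x) :
    ∫ x, f x ∂(unif (lpBall (m + 2) p)) =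
      (mom m p 2 0 + mom m p 0 2) / 4 - mom m p 1 1 / 2 := by
  rw [unif_integral hp]
  simp only [hf]
  have i1 := (ball_integrable (m := m) hp 2 0).const_mul (1 / 4)
  have i2 := (ball_integrable (m := m) hp 0 2).const_mul (1 / 4)
  have i12 := i1.add i2
  simp only [Pi.add_def] at i12
  have i3 := (ball_integrable (m := m) hp 1 1).const_mul (-1 / 2)
  rw [integral_add i12 i3, integral_add i1 i2]
  simp only [integral_const_mul]
  rw [ball_integral hp, ball_integral hp, ball_integral hp, mom, mom, mom]
  ring

end CovAux

/-- explicit values of `f(e₁,e₂)` and `f(ξ₁,ξ₂)` on `B_p^n` in terms of the Gamma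
function, where `F(x) = Γ(5x)Γ(x)/Γ(3x)²`. -/
theorem covf_values_Bpn (n : ℕ) (hn : 2 ≤ n) (p : ℝ) (hp : 1 ≤ p) :
    covf (unif (lpBall n p)) (stdb (⟨0, by omega⟩ : Fin n)) (stdb ⟨1, by omega⟩) =
      Real.Gamma (1 + n / p) * Real.Gamma (3 / p) ^ 2 /
        (Real.Gamma (1 + (n + 4) / p) * Real.Gamma (1 / p) ^ 2) *
        (1 - Real.Gamma (1 + n / p) * Real.Gamma (1 + (n + 4) / p) /
          Real.Gamma (1 + (n + 2) / p) ^ 2) ∧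
    covf (unif (lpBall n p))
        ((Real.sqrt 2)⁻¹ • (stdb (⟨0, by omega⟩ : Fin n) + stdb ⟨1, by omega⟩))
        ((Real.sqrt 2)⁻¹ • (stdb (⟨0, by omega⟩ : Fin n) - stdb ⟨1, by omega⟩)) =
      Real.Gamma (1 + n / p) * Real.Gamma (3 / p) ^ 2 *
          (Real.Gamma (5 * (1 / p)) * Real.Gamma (1 / p) / Real.Gamma (3 * (1 / p)) ^ 2 - 1 -
            2 * Real.Gamma (1 + n / p) * Real.Gamma (1 + (n + 4) / p) /
              Real.Gamma (1 + (n + 2) / p) ^ 2) /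
        (2 * Real.Gamma (1 + (n + 4) / p) * Real.Gamma (1 / p) ^ 2) := by
  obtain ⟨m, rfl⟩ : ∃ m, n = m + 2 := ⟨n - 2, by omega⟩
  have hp0 : 0 < p := by linarith
  have e0 : (⟨0, by omega⟩ : Fin (m + 2)) = 0 := rfl
  have e1 : (⟨1, by omega⟩ : Fin (m + 2)) = 1 := rfl
  have hs : (Real.sqrt 2)⁻¹ ^ 2 = 1 / 2 := by
    rw [inv_pow, Real.sq_sqrt (by norm_num)]
    norm_num
  have g1 : Real.Gamma (1 / p) ≠ 0 := (Real.Gamma_pos_of_pos (by positivity)).ne'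
  have g3 : Real.Gamma (3 / p) ≠ 0 := (Real.Gamma_pos_of_pos (by positivity)).ne'
  have n2 : Real.Gamma (1 + (((m + 2 : ℕ) : ℝ) + 2) / p) ≠ 0 :=
    (Real.Gamma_pos_of_pos (by positivity)).ne'
  have n4 : Real.Gamma (1 + (((m + 2 : ℕ) : ℝ) + 4) / p) ≠ 0 :=
    (Real.Gamma_pos_of_pos (by positivity)).ne'
  have a3 : 3 * (1 / p) = 3 / p := by ring
  have a5 : 5 * (1 / p) = 5 / p := by ring
  have m10 := CovAux.mom_eq m hp0 1 0
  have m01 := CovAux.mom_eq m hp0 0 1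
  have m11 := CovAux.mom_eq m hp0 1 1
  have m20 := CovAux.mom_eq m hp0 2 0
  have m02 := CovAux.mom_eq m hp0 0 2
  have c2 : ((2 : ℕ) : ℝ) = 2 := by norm_num
  have c4 : ((4 : ℕ) : ℝ) = 4 := by norm_num
  have f1 : (2 : ℝ) * 1 + 1 = 3 := by norm_num
  have f2 : (2 : ℝ) * 2 + 1 = 5 := by norm_num
  simp only [Nat.cast_zero, Nat.cast_one, mul_zero, mul_one, zero_add, add_zero, Nat.reduceMul,
    Nat.reduceAdd, c2, c4, f1, f2] at m10 m01 m11 m20 m02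
  norm_num only at m10 m01 m11 m20 m02
  rw [e0, e1, a3, a5]
  constructor
  · unfold covf
    rw [CovAux.E_mono hp0 1 1 _ (fun x => by simp [CovAux.inner_stdb, CovAux.mono]),
      CovAux.E_mono hp0 1 0 _ (fun x => by simp [CovAux.inner_stdb, CovAux.mono]),
      CovAux.E_mono hp0 0 1 _ (fun x => by simp [CovAux.inner_stdb, CovAux.mono]),
      m11, m10, m01]
    generalize Real.Gamma (1 + ((m + 2 : ℕ) : ℝ) / p) = N0 at *
    generalize Real.Gamma (1 + (((m + 2 : ℕ) : ℝ) + 2) / p) = N2 at *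
    generalize Real.Gamma (1 + (((m + 2 : ℕ) : ℝ) + 4) / p) = N4 at *
    generalize Real.Gamma (1 / p) = G1 at *
    generalize Real.Gamma (3 / p) = G3 at *
    field_simp
  · unfold covf
    rw [CovAux.E_quart hp0 _ (fun x => by
        simp only [real_inner_smul_right, inner_add_right, inner_sub_right, CovAux.inner_stdb,
          CovAux.mono, mul_pow, hs]
        ring),
      CovAux.E_quad hp0 1 _ (fun x => by
        simp only [real_inner_smul_right, inner_add_right, CovAux.inner_stdb,
          CovAux.mono, mul_pow, hs]
        ring),
      CovAux.E_quad hp0 (-1) _ (fun x => by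
        simp only [real_inner_smul_right, inner_sub_right, CovAux.inner_stdb,
          CovAux.mono, mul_pow, hs]
        ring),
      m11, m10, m01, m20, m02]
    generalize Real.Gamma (1 + ((m + 2 : ℕ) : ℝ) / p) = N0 at *
    generalize Real.Gamma (1 + (((m + 2 : ℕ) : ℝ) + 2) / p) = N2 at *
    generalize Real.Gamma (1 + (((m + 2 : ℕ) : ℝ) + 4) / p) = N4 at *
    generalize Real.Gamma (1 / p) = G1 at *
    generalize Real.Gamma (3 / p) = G3 at *
    generalize Real.Gamma (5 / p) = G5 at *
    field_simp
    ring
end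
end
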